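/- Let A be an essential finite arrangement of N affine hyperplanes in ℂ^ℓ with defining degree-one polynomials f₁, …, f_N, and let M(A) = ℂ^ℓ ∖ ⋃_i {f_i = 0}. For λ = (λ₁, …, λ_N) ∈ ℂ^N define the logarithmic 1-form ω_λ : M(A) → (ℂ^ℓ)* by ω_λ(x) = Σ_{i=1}^{N} λ_i · f_i(x)^{-1} · df_i, where df_i ∈ (ℂ^ℓ)* is the (constant) linear part of f_i. Then there exists a proper Zariski-closed algebraic subset Y ⊊ ℂ^N such that for every λ ∈ ℂ^N ∖ Y: the critical set {x ∈ M(A) : ω_λ(x) = 0} is finite, at each of its points the derivative of the map ω_λ : M(A) → (ℂ^ℓ)* is a linear isomorphism (all critical points are nondegenerate), and the number of critical points equals β(A) = |π(A,−1)|. -/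

import Mathlib

open scoped Classical

noncomputable section

variable (K : Type) [Field K] {V : Type} [AddCommGroup V] [Module K V]

/-- An affine hyperplane in `V`: the level set of a nonzero linear functional. -/
def IsHyperplane (H : Set V) : Prop :=
  ∃ (f : V →ₗ[K] K) (c : K), f ≠ 0 ∧ H = {x | f x = c}

/-- The dimension of a subset of `V`: the dimension of its affine span. -/
def flatDim (X : Set V) : ℕ := Module.finrank K (affineSpan K X).direction

/-- The intersection poset `L(A)` of the arrangement `A` inside the ambient set `W`:
all nonempty intersections of subfamilies of `A` (intersected with the ambient `W`),
the empty subfamily giving `W` itself. -/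
def interPosetIn (W : Set V) (A : Finset (Set V)) : Finset (Set V) :=
  (A.powerset.image fun S => W ∩ ⋂ H ∈ S, H).filter fun X => X.Nonempty

/-- The rank of `X`: its codimension within the ambient space `W`. -/
def rkIn (W X : Set V) : ℕ := flatDim K W - flatDim K X

/-- `μ` satisfies the defining recursion of the Möbius function of the poset
`L(A)` inside the ambient set `W`.  `L(A)` is ordered by reverse inclusion, so the
condition `μ(W) = 1`, `μ(X) = -∑_{Y < X} μ(Y)` for `X > W` is equivalent to:
for every `X ∈ L(A)`, `∑_{Y ⊇ X} μ(Y)` is `1` if `X = W` and `0` otherwise. -/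
def IsMobiusIn (W : Set V) (A : Finset (Set V)) (μ : Set V → ℤ) : Prop :=
  ∀ X ∈ interPosetIn W A,
    (∑ Y ∈ (interPosetIn W A).filter fun Y => X ⊆ Y, μ Y) = if X = W then 1 else 0

/-- The Poincaré polynomial `π(A,t) = ∑_{X ∈ L(A)} μ(X) (-t)^{r(X)}`. -/
def poinIn (W : Set V) (A : Finset (Set V)) (μ : Set V → ℤ) : Polynomial ℤ :=
  ∑ X ∈ interPosetIn W A, Polynomial.C (μ X) * (- Polynomial.X) ^ (rkIn K W X)

/-- A chamber of the arrangement `A` within the ambient set `W`: a connected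
component of `W ∖ ⋃_{H ∈ A} H`. -/
def IsChamberIn [TopologicalSpace V] (W : Set V) (A : Finset (Set V)) (C : Set V) : Prop :=
  ∃ x ∈ W ∩ (⋃ H ∈ A, (H : Set V))ᶜ, C = connectedComponentIn (W ∩ (⋃ H ∈ A, (H : Set V))ᶜ) x

/-- `F` is a generic (transversal) `q`-dimensional affine subspace for the
arrangement `A`: it is (the carrier of) an affine subspace of dimension `q`, and
for every `X ∈ L(A)`, if `r(X) ≤ q` then `F ∩ X` is nonempty of dimension
`q - r(X)`, and if `r(X) > q` then `F ∩ X = ∅`. -/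
def IsGenericFlat (q : ℕ) (A : Finset (Set V)) (F : Set V) : Prop :=
  (∃ W : AffineSubspace K V, (W : Set V) = F) ∧ F.Nonempty ∧ flatDim K F = q ∧
  ∀ X ∈ interPosetIn Set.univ A,
    (rkIn K Set.univ X ≤ q → (F ∩ X).Nonempty ∧ flatDim K (F ∩ X) = q - rkIn K Set.univ X) ∧
    (q < rkIn K Set.univ X → F ∩ X = ∅)

end

/-- The logarithmic 1-form `ω_λ(x) = ∑ i, λ_i f_i(x)⁻¹ df_i` attached to the degree-one
polynomials `f_i(x) = ∑ j, c i j * x j + d i`, where `df_i` is the constant linear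
functional `z ↦ ∑ j, c i j * z j`. -/
noncomputable def masterForm {ℓ N : ℕ} (c : Fin N → Fin ℓ → ℂ) (d : Fin N → ℂ)
    (lam : Fin N → ℂ) (x : Fin ℓ → ℂ) : (Fin ℓ → ℂ) →L[ℂ] ℂ :=
  ∑ i, (lam i * ((∑ j, c i j * x j) + d i)⁻¹) •
    (∑ j, c i j • (ContinuousLinearMap.proj j : (Fin ℓ → ℂ) →L[ℂ] ℂ))

open MvPolynomial in
theorem exists_relation {ι : Type} [Finite ι] (Ψ : ι → MvPolynomial ι ℂ) (g : MvPolynomial ι ℂ) :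
    ∃ Q : Polynomial (MvPolynomial ι ℂ), Q ≠ 0 ∧
      Q.eval₂ (aeval Ψ : MvPolynomial ι ℂ →ₐ[ℂ] MvPolynomial ι ℂ).toRingHom g = 0 := by
  have hdep : ¬ AlgebraicIndependent ℂ (fun o : Option ι => o.elim g Ψ) := by
    intro h
    have h1 := h.cardinalMk_le_trdeg
    rw [MvPolynomial.trdeg_of_isDomain, Cardinal.lift_id] at h1
    have := Fintype.ofFinite ι
    rw [Cardinal.mk_fintype, Cardinal.mk_fintype] at h1
    have h2 := Nat.cast_le.1 h1
    simp at h2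
  rw [algebraicIndependent_iff] at hdep
  push Not at hdep
  obtain ⟨p, hp, hp0⟩ := hdep
  refine ⟨optionEquivLeft ℂ ι p, by simpa using hp0, ?_⟩
  rw [← hp]
  have : (Polynomial.eval₂RingHom
      (aeval Ψ : MvPolynomial ι ℂ →ₐ[ℂ] MvPolynomial ι ℂ).toRingHom g).comp
      (optionEquivLeft ℂ ι).toRingEquiv.toRingHom =
      (aeval (fun o : Option ι => o.elim g Ψ) : MvPolynomial (Option ι) ℂ →ₐ[ℂ] _).toRingHom := by
    apply MvPolynomial.ringHom_ext
    · intro r; simp [optionEquivLeft_C]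
    · intro o; cases o <;> simp [optionEquivLeft_X_none, optionEquivLeft_X_some]
  exact congrArg (fun φ => φ p) this

open MvPolynomial in
theorem exists_minimal_relation {ι : Type} [Finite ι] (Ψ : ι → MvPolynomial ι ℂ)
    (g : MvPolynomial ι ℂ) :
    ∃ Q : Polynomial (MvPolynomial ι ℂ), Q ≠ 0 ∧
      Q.eval₂ (aeval Ψ : MvPolynomial ι ℂ →ₐ[ℂ] MvPolynomial ι ℂ).toRingHom g = 0 ∧
      ∀ Q' : Polynomial (MvPolynomial ι ℂ), Q' ≠ 0 → Q'.natDegree < Q.natDegree →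
        Q'.eval₂ (aeval Ψ : MvPolynomial ι ℂ →ₐ[ℂ] MvPolynomial ι ℂ).toRingHom g ≠ 0 := by
  let T : Set (Polynomial (MvPolynomial ι ℂ)) := {Q | Q ≠ 0 ∧
      Q.eval₂ (aeval Ψ : MvPolynomial ι ℂ →ₐ[ℂ] MvPolynomial ι ℂ).toRingHom g = 0}
  have hT : T.Nonempty := exists_relation Ψ g
  obtain ⟨Q, ⟨hQ0, hQ⟩, hmin⟩ := WellFounded.has_min (measure Polynomial.natDegree).wf T hT
  exact ⟨Q, hQ0, hQ, fun Q' h0 hlt h => hmin Q' ⟨h0, h⟩ hlt⟩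

open MvPolynomial in
theorem exists_polynomial_fiber_ne_zero {ι : Type} [Finite ι] (Ψ : ι → MvPolynomial ι ℂ)
    {g : MvPolynomial ι ℂ} (hg : g ≠ 0) :
    ∃ P : MvPolynomial ι ℂ, P ≠ 0 ∧
      ∀ w : ι → ℂ, eval (fun k => eval w (Ψ k)) P ≠ 0 → eval w g ≠ 0 := by
  obtain ⟨Q, hQ0, hQ, hmin⟩ := exists_minimal_relation Ψ g
  have hcoeff : Q.coeff 0 ≠ 0 := by
    intro h0
    have hX : Q.divX * Polynomial.X = Q := by
      have := Q.divX_mul_X_add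
      rwa [h0, map_zero, add_zero] at this
    have hd0 : Q.divX ≠ 0 := by
      intro h
      rw [h, zero_mul] at hX
      exact hQ0 hX.symm
    refine hmin Q.divX hd0 ?_ ?_
    · conv_rhs => rw [← hX, Polynomial.natDegree_mul_X hd0]
      exact Nat.lt_succ_self _
    · rw [← hX, Polynomial.eval₂_mul, Polynomial.eval₂_X] at hQ
      exact (mul_eq_zero.1 hQ).resolve_right hg
  refine ⟨Q.coeff 0, hcoeff, fun w hw hgw => hw ?_⟩
  have h1 := congrArg (eval w) hQ
  have hc : ((eval w).comp (aeval Ψ : MvPolynomial ι ℂ →ₐ[ℂ] MvPolynomial ι ℂ).toRingHom) =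
      eval (fun k => eval w (Ψ k)) := by
    apply MvPolynomial.ringHom_ext <;> simp
  rw [Polynomial.hom_eval₂, hc, hgw, map_zero, Polynomial.eval₂_at_zero] at h1
  exact h1

open MvPolynomial in
/-- For a polynomial self-map `Ψ` of affine space, the kernel of the derivative (expressed
through dual numbers) is trivial over the complement of a hypersurface. -/
theorem exists_polynomial_fiber_unramified {ι : Type} [Finite ι] (Ψ : ι → MvPolynomial ι ℂ) :
    ∃ P : MvPolynomial ι ℂ, P ≠ 0 ∧
      ∀ w v : ι → ℂ, eval (fun k => eval w (Ψ k)) P ≠ 0 →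
        (∀ k, aeval (fun j => (TrivSqZeroExt.inl (w j) + TrivSqZeroExt.inr (v j) : DualNumber ℂ))
          (Ψ k) = TrivSqZeroExt.inl (eval w (Ψ k))) → v = 0 := by
  have key : ∀ j : ι, ∃ P : MvPolynomial ι ℂ, P ≠ 0 ∧
      ∀ w v : ι → ℂ, eval (fun k => eval w (Ψ k)) P ≠ 0 →
        (∀ k, aeval (fun j => (TrivSqZeroExt.inl (w j) + TrivSqZeroExt.inr (v j) : DualNumber ℂ))
          (Ψ k) = TrivSqZeroExt.inl (eval w (Ψ k))) → v j = 0 := by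
    intro j
    obtain ⟨Q, hQ0, hQ, hmin⟩ := exists_minimal_relation Ψ (X j)
    have hev : ∀ w : ι → ℂ,
        ((eval w).comp (aeval Ψ : MvPolynomial ι ℂ →ₐ[ℂ] MvPolynomial ι ℂ).toRingHom) =
        eval (fun k => eval w (Ψ k)) := by
      intro w
      apply MvPolynomial.ringHom_ext <;> simp
    by_cases hdeg : Q.natDegree = 0
    · obtain ⟨p, rfl⟩ := Polynomial.natDegree_eq_zero.1 hdeg
      refine ⟨p, by simpa using hQ0, fun w v hw => (hw ?_).elim⟩
      have h1 := congrArg (eval w) hQ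
      rw [Polynomial.hom_eval₂, hev, Polynomial.eval₂_C, map_zero] at h1
      exact h1
    have hder0 : Q.derivative ≠ 0 := by
      intro h
      exact hdeg (Polynomial.derivative_eq_zero.1 h)
    have hder := hmin Q.derivative hder0 (Polynomial.natDegree_derivative_lt hdeg)
    obtain ⟨P, hP0, hP⟩ := exists_polynomial_fiber_ne_zero Ψ hder
    refine ⟨P, hP0, fun w v hw hv => ?_⟩
    have h1 := hP w hw
    rw [Polynomial.hom_eval₂, hev, eval_X, ← Polynomial.eval_map] at h1
    have h2 := congrArg (aeval (R := ℂ) (fun j =>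
      (TrivSqZeroExt.inl (w j) + TrivSqZeroExt.inr (v j) : DualNumber ℂ))).toRingHom hQ
    have hc : ((aeval (R := ℂ) (fun j =>
        (TrivSqZeroExt.inl (w j) + TrivSqZeroExt.inr (v j) : DualNumber ℂ))).toRingHom.comp
        (aeval Ψ : MvPolynomial ι ℂ →ₐ[ℂ] MvPolynomial ι ℂ).toRingHom) =
        (TrivSqZeroExt.inlHom ℂ ℂ).comp (eval (fun k => eval w (Ψ k))) := by
      apply MvPolynomial.ringHom_ext
      · intro r
        simp [TrivSqZeroExt.algebraMap_eq_inl]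
      · intro k
        simpa using hv k
    rw [Polynomial.hom_eval₂, hc, ← Polynomial.eval_map, map_zero] at h2
    simp only [AlgHom.toRingHom_eq_coe, RingHom.coe_coe, aeval_X] at h2
    rw [Polynomial.eval_add_of_sq_eq_zero _ _ _ (by
      rw [pow_two, TrivSqZeroExt.inr_mul_inr])] at h2
    rw [← Polynomial.map_map, Polynomial.derivative_map] at h2
    have h3 := congrArg TrivSqZeroExt.snd h2
    have e1 : ∀ q : Polynomial ℂ, Polynomial.eval (TrivSqZeroExt.inl (w j) : DualNumber ℂ)
        (q.map (TrivSqZeroExt.inlHom ℂ ℂ)) = TrivSqZeroExt.inl (q.eval (w j)) := by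
      intro q
      exact Polynomial.eval_map_apply (TrivSqZeroExt.inlHom ℂ ℂ) (w j)
    rw [e1, e1] at h3
    rw [Polynomial.derivative_map] at h3
    simp only [TrivSqZeroExt.snd_add, TrivSqZeroExt.snd_inl, TrivSqZeroExt.inl_mul_inr,
      TrivSqZeroExt.snd_inr, zero_add, TrivSqZeroExt.snd_zero, smul_eq_mul] at h3
    exact (mul_eq_zero.1 h3).resolve_left h1
  choose P hP0 hP using key
  have := Fintype.ofFinite ι
  refine ⟨∏ j, P j, Finset.prod_ne_zero_iff.2 fun j _ => hP0 j, fun w v hw hv => ?_⟩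
  funext j
  rw [map_prod] at hw
  exact hP j w v (Finset.prod_ne_zero_iff.1 hw j (Finset.mem_univ j)) hv

section Arrangement

variable {ι : Type} [Fintype ι] {V : Type} [NormedAddCommGroup V] [NormedSpace ℂ V]

/-- The logarithmic form `∑ i, λ_i dα_i / α_i` of the affine functions `α_i = c i + d i`. -/
noncomputable def logForm (c : ι → V →L[ℂ] ℂ) (d lam : ι → ℂ) (x : V) : V →L[ℂ] ℂ :=
  ∑ i, (lam i * (c i x + d i)⁻¹) • c i

/-- The zeros of the logarithmic form on the complement of the arrangement. -/
def critSet (c : ι → V →L[ℂ] ℂ) (d lam : ι → ℂ) : Set V :=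
  {x | (∀ i, c i x + d i ≠ 0) ∧ logForm c d lam x = 0}

/-- The derivative of the logarithmic form. -/
noncomputable def logHess (c : ι → V →L[ℂ] ℂ) (d lam : ι → ℂ) (x : V) : V →L[ℂ] V →L[ℂ] ℂ :=
  ∑ i, (-(lam i * ((c i x + d i) ^ 2)⁻¹)) • (c i).smulRight (c i)

/-- The linear parts have no common kernel. -/
def IsEssential (c : ι → V →L[ℂ] ℂ) : Prop := ∀ v, (∀ i, c i v = 0) → v = 0

theorem finrank_continuousDual [FiniteDimensional ℂ V] :
    Module.finrank ℂ (V →L[ℂ] ℂ) = Module.finrank ℂ V := by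
  rw [← Subspace.dual_finrank_eq (K := ℂ) (V := V)]
  exact (LinearMap.toContinuousLinearMap (𝕜 := ℂ) (E := V) (F' := ℂ)).finrank_eq.symm

theorem exists_linearEquiv_prod_relations [FiniteDimensional ℂ V]
    {c : ι → V →L[ℂ] ℂ} (hc : IsEssential c) :
    Nonempty ((ι → ℂ) ≃ₗ[ℂ] V × LinearMap.ker (Fintype.linearCombination ℂ c)) := by
  have hsurj : LinearMap.range (Fintype.linearCombination ℂ c) = ⊤ := by
    rw [LinearMap.range_eq_top]
    intro α
    let L : V →ₗ[ℂ] (ι → ℂ) := LinearMap.pi fun i => (c i).toLinearMap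
    have hL : LinearMap.ker L = ⊥ := by
      rw [LinearMap.ker_eq_bot']
      intro v hv
      exact hc v fun i => congrFun hv i
    obtain ⟨g, hg⟩ := L.exists_leftInverse_of_injective hL
    refine ⟨fun i => α (g (Pi.single i 1)), ?_⟩
    ext v
    have h1 : g (L v) = v := LinearMap.congr_fun hg v
    conv_rhs => rw [← h1, ← Finset.univ_sum_single (L v)]
    simp only [map_sum, Fintype.linearCombination_apply, sum_apply,
      smul_apply, smul_eq_mul]
    refine Finset.sum_congr rfl fun i _ => ?_
    have h2 : (Pi.single i (L v i) : ι → ℂ) = c i v • Pi.single i (1 : ℂ) := by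
      rw [← Pi.single_smul]
      simp [L]
    rw [h2, map_smul, map_smul, smul_eq_mul, mul_comm]
  refine ⟨LinearEquiv.ofFinrankEq _ _ ?_⟩
  have := LinearMap.finrank_range_add_finrank_ker (Fintype.linearCombination ℂ c)
  rw [hsurj, finrank_top, finrank_continuousDual] at this
  rw [Module.finrank_prod, this]

/-- The homogeneous linear polynomial attached to a linear functional. -/
noncomputable def linPoly (φ : (ι → ℂ) →ₗ[ℂ] ℂ) : MvPolynomial ι ℂ :=
  ∑ i, MvPolynomial.C (φ (Pi.single i 1)) * MvPolynomial.X i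

theorem sum_single_mul (φ : (ι → ℂ) →ₗ[ℂ] ℂ) (w : ι → ℂ) :
    ∑ i, φ (Pi.single i 1) * w i = φ w := by
  conv_rhs => rw [← Finset.univ_sum_single w, map_sum]
  refine Finset.sum_congr rfl fun i _ => ?_
  have h2 : (Pi.single i (w i) : ι → ℂ) = w i • Pi.single i (1 : ℂ) := by
    rw [← Pi.single_smul]
    simp
  rw [h2, map_smul, smul_eq_mul, mul_comm]

theorem eval_linPoly (φ : (ι → ℂ) →ₗ[ℂ] ℂ) (w : ι → ℂ) :
    MvPolynomial.eval w (linPoly φ) = φ w := by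
  simp [linPoly, sum_single_mul]

theorem aeval_dual_linPoly (φ : (ι → ℂ) →ₗ[ℂ] ℂ) (w v : ι → ℂ) :
    MvPolynomial.aeval
      (fun j => (TrivSqZeroExt.inl (w j) + TrivSqZeroExt.inr (v j) : DualNumber ℂ)) (linPoly φ) =
      TrivSqZeroExt.inl (φ w) + TrivSqZeroExt.inr (φ v) := by
  simp only [linPoly, map_sum, map_mul, MvPolynomial.aeval_C, MvPolynomial.aeval_X]
  rw [← sum_single_mul φ w, ← sum_single_mul φ v]
  ext <;> simp [TrivSqZeroExt.algebraMap_eq_inl, TrivSqZeroExt.fst_sum, TrivSqZeroExt.snd_sum]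

theorem linPoly_add_C_ne_zero {φ : (ι → ℂ) →ₗ[ℂ] ℂ} (hφ : φ ≠ 0) (b : ℂ) :
    linPoly φ + MvPolynomial.C b ≠ 0 := by
  intro h
  apply hφ
  ext w
  have h1 := congrArg (MvPolynomial.eval (Pi.single w 1)) h
  have h0 := congrArg (MvPolynomial.eval 0) h
  simp only [map_add, eval_linPoly, MvPolynomial.eval_C, map_zero, zero_add] at h1 h0
  subst h0
  simpa using h1

/-- The critical points of all master functions, parametrized polynomially. -/
theorem exists_critical_parametrization [FiniteDimensional ℂ V] {c : ι → V →L[ℂ] ℂ}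
    (hc : IsEssential c) (d : ι → ℂ) :
    ∃ (Ψ : ι → MvPolynomial ι ℂ) (ξ : (ι → ℂ) →ₗ[ℂ] V), Function.Surjective ξ ∧
      (∀ lam, ∀ x ∈ critSet c d lam, ∃ w, ξ w = x ∧ ∀ k, MvPolynomial.eval w (Ψ k) = lam k) ∧
      ∀ lam, ∀ x ∈ critSet c d lam, ∀ x', logHess c d lam x x' = 0 → ∃ w v, ξ w = x ∧ ξ v = x' ∧
        (∀ k, MvPolynomial.eval w (Ψ k) = lam k) ∧
        ∀ k, MvPolynomial.aeval
          (fun j => (TrivSqZeroExt.inl (w j) + TrivSqZeroExt.inr (v j) : DualNumber ℂ)) (Ψ k) =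
          TrivSqZeroExt.inl (lam k) := by
  obtain ⟨e⟩ := exists_linearEquiv_prod_relations hc
  let ξ : (ι → ℂ) →ₗ[ℂ] V := LinearMap.fst ℂ _ _ ∘ₗ e.toLinearMap
  let η : ι → (ι → ℂ) →ₗ[ℂ] ℂ := fun k =>
    LinearMap.proj k ∘ₗ (Submodule.subtype _ ∘ₗ (LinearMap.snd ℂ _ _ ∘ₗ e.toLinearMap))
  have hlift : ∀ (x : V) (u : ι → ℂ), ∑ i, u i • c i = 0 → ∃ w, ξ w = x ∧ ∀ k, η k w = u k := by
    intro x u hu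
    refine ⟨e.symm (x, ⟨u, by simpa [Fintype.linearCombination_apply] using hu⟩), ?_, ?_⟩
    · simp [ξ]
    · intro k
      simp [η]
  have hzero : ∀ lam, ∀ x ∈ critSet c d lam,
      ∑ i, (fun i => lam i * (c i x + d i)⁻¹) i • c i = 0 := fun lam x hx => hx.2
  refine ⟨fun k => linPoly (η k) * (linPoly ((c k).toLinearMap ∘ₗ ξ) + MvPolynomial.C (d k)), ξ,
    Prod.fst_surjective.comp e.surjective, ?_, ?_⟩
  · intro lam x hx
    obtain ⟨w, hw, hwu⟩ := hlift x _ (hzero lam x hx)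
    refine ⟨w, hw, fun k => ?_⟩
    have := hx.1 k
    simp only [map_mul, map_add, eval_linPoly, MvPolynomial.eval_C, hwu, LinearMap.comp_apply, hw,
      ContinuousLinearMap.coe_coe]
    field_simp
  · intro lam x hx x' hx'
    obtain ⟨w, hw, hwu⟩ := hlift x _ (hzero lam x hx)
    obtain ⟨v, hv, hvu⟩ := hlift x' (fun i => -(lam i * ((c i x + d i) ^ 2)⁻¹) * c i x') (by
      rw [← hx']
      simp [logHess, smul_smul])
    refine ⟨w, v, hw, hv, fun k => ?_, fun k => ?_⟩
    · have := hx.1 k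
      simp only [map_mul, map_add, eval_linPoly, MvPolynomial.eval_C, hwu, LinearMap.comp_apply, hw,
        ContinuousLinearMap.coe_coe]
      field_simp
    · have := hx.1 k
      simp only [map_mul, map_add, aeval_dual_linPoly, MvPolynomial.aeval_C, hwu, hvu,
        LinearMap.comp_apply, hw, hv, ContinuousLinearMap.coe_coe, TrivSqZeroExt.algebraMap_eq_inl]
      ext
      · simp
        field_simp
      · simp
        field_simp
        ring

theorem exists_polynomial_nondegenerate [FiniteDimensional ℂ V] {c : ι → V →L[ℂ] ℂ}
    (hc : IsEssential c) (d : ι → ℂ) :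
    ∃ P : MvPolynomial ι ℂ, P ≠ 0 ∧ ∀ lam, MvPolynomial.eval lam P ≠ 0 →
      ∀ x ∈ critSet c d lam, ∀ x', logHess c d lam x x' = 0 → x' = 0 := by
  obtain ⟨Ψ, ξ, -, -, hΨ⟩ := exists_critical_parametrization hc d
  obtain ⟨P, hP0, hP⟩ := exists_polynomial_fiber_unramified Ψ
  refine ⟨P, hP0, fun lam hlam x hx x' hx' => ?_⟩
  obtain ⟨w, v, hw, rfl, hwΨ, hv⟩ := hΨ lam x hx x' hx'
  rw [hP w v (by simpa only [hwΨ] using hlam) (by simpa only [hwΨ] using hv), map_zero]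

theorem exists_polynomial_critSet_avoids [FiniteDimensional ℂ V] {c : ι → V →L[ℂ] ℂ}
    (hc : IsEssential c) (d : ι → ℂ) {a : V →L[ℂ] ℂ} (ha : a ≠ 0) (b : ℂ) :
    ∃ P : MvPolynomial ι ℂ, P ≠ 0 ∧ ∀ lam, MvPolynomial.eval lam P ≠ 0 →
      ∀ x ∈ critSet c d lam, a x + b ≠ 0 := by
  obtain ⟨Ψ, ξ, hξ, hΨ, -⟩ := exists_critical_parametrization hc d
  have hne : a.toLinearMap ∘ₗ ξ ≠ 0 := by
    intro h
    apply ha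
    ext x
    obtain ⟨w, rfl⟩ := hξ x
    exact LinearMap.congr_fun h w
  obtain ⟨P, hP0, hP⟩ := exists_polynomial_fiber_ne_zero Ψ (linPoly_add_C_ne_zero hne b)
  refine ⟨P, hP0, fun lam hlam x hx => ?_⟩
  obtain ⟨w, rfl, hwΨ⟩ := hΨ lam x hx
  simpa [eval_linPoly] using hP w (by simpa only [hwΨ] using hlam)

open Filter Topology

theorem hasFDerivAt_logForm {c : ι → V →L[ℂ] ℂ} {d : ι → ℂ} (lam : ι → ℂ) {x : V}
    (hx : ∀ i, c i x + d i ≠ 0) : HasFDerivAt (logForm c d lam) (logHess c d lam x) x := by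
  unfold logForm logHess
  refine HasFDerivAt.fun_sum fun i _ => ?_
  have h1 : HasFDerivAt (fun y => c i y + d i) (c i) x := (c i).hasFDerivAt.add_const _
  have h2 := ((hasDerivAt_inv (hx i)).comp_hasFDerivAt x h1).const_mul (lam i)
  refine (h2.smul_const (c i)).congr_fderiv ?_
  ext v w
  simp
  ring

theorem contDiffAt_logForm {c : ι → V →L[ℂ] ℂ} {d : ι → ℂ} {z : (ι → ℂ) × V}
    (hz : ∀ i, c i z.2 + d i ≠ 0) :
    ContDiffAt ℂ 1 (fun z : (ι → ℂ) × V => logForm c d z.1 z.2) z := by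
  unfold logForm
  refine ContDiffAt.sum fun i _ => ?_
  have h1 : ContDiffAt ℂ 1 (fun z : (ι → ℂ) × V => c i z.2 + d i) z := by fun_prop
  have h2 : ContDiffAt ℂ 1 (fun z : (ι → ℂ) × V => z.1 i) z := by fun_prop
  exact (h2.mul (h1.inv (hz i))).smul contDiffAt_const

/-- The implicit function theorem for a family of equations `G (lam, x) = 0` in `V`. -/
theorem exists_implicit_zero [FiniteDimensional ℂ V] {G : (ι → ℂ) × V → V →L[ℂ] ℂ}
    {lam0 : ι → ℂ} {p : V} (hG : ContDiffAt ℂ 1 G (lam0, p)) (h0 : G (lam0, p) = 0)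
    {D : V →L[ℂ] V →L[ℂ] ℂ} (hD : HasFDerivAt (fun x => G (lam0, x)) D p)
    (hinj : ∀ v, D v = 0 → v = 0) :
    ∃ φ : (ι → ℂ) → V, Tendsto φ (𝓝 lam0) (𝓝 p) ∧
      ∀ᶠ z in 𝓝 (lam0, p), G z = 0 ↔ φ z.1 = z.2 := by
  have := FiniteDimensional.complete ℂ V
  have hs := hG.hasStrictFDerivAt (by simp)
  have hpart : fderiv ℂ G (lam0, p) ∘L .inr ℂ (ι → ℂ) V = D := by
    have h1 : HasFDerivAt (fun x : V => (lam0, x)) (.inr ℂ (ι → ℂ) V) p :=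
      hasFDerivAt_prodMk_right lam0 p
    exact (hs.hasFDerivAt.comp p h1).unique hD
  have hinv : (fderiv ℂ G (lam0, p) ∘L .inr ℂ (ι → ℂ) V).IsInvertible := by
    rw [hpart]
    have hker : Function.Injective D.toLinearMap := (injective_iff_map_eq_zero _).2 hinj
    let e := LinearEquiv.ofInjectiveOfFinrankEq D.toLinearMap hker finrank_continuousDual.symm
    exact ⟨e.toContinuousLinearEquiv, by ext; rfl⟩
  refine ⟨hs.implicitFunctionOfProdDomain hinv, hs.tendsto_implicitFunctionOfProdDomain hinv, ?_⟩
  have := hs.eventually_apply_eq_iff_implicitFunctionOfProdDomain hinv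
  rwa [h0] at this

/-- A family of sets whose points stay near finitely many points, close to each of which the
family is given by a single moving point, has constant cardinality. -/
theorem eventually_natCard_eq {Λ X : Type*} [TopologicalSpace X] [T2Space X] {C : Λ → Set X}
    {P : Finset X} {F : Filter Λ} {φ : X → Λ → X} (hφ : ∀ p ∈ P, Tendsto (φ p) F (𝓝 p))
    (hloc : ∀ p ∈ P, ∀ᶠ z in F ×ˢ 𝓝 p, z.2 ∈ C z.1 ↔ φ p z.1 = z.2)
    (hesc : ∀ 𝒰 : Ultrafilter (Λ × X), Tendsto Prod.fst (𝒰 : Filter (Λ × X)) F →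
      (∀ᶠ z in (𝒰 : Filter (Λ × X)), z.2 ∈ C z.1) →
      ∃ p ∈ P, Tendsto Prod.snd (𝒰 : Filter (Λ × X)) (𝓝 p)) :
    ∀ᶠ lam in F, Nat.card (C lam) = P.card := by
  have h1 : ∀ᶠ lam in F, ∀ p ∈ P, φ p lam ∈ C lam := by
    rw [Filter.eventually_all_finset]
    intro p hp
    filter_upwards [(tendsto_id.prodMk (hφ p hp)).eventually (hloc p hp)] with lam hlam
    exact hlam.2 rfl
  have h2 : ∀ᶠ lam in F, ∀ p ∈ P, ∀ q ∈ P, p ≠ q → φ p lam ≠ φ q lam := by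
    rw [Filter.eventually_all_finset]
    intro p hp
    rw [Filter.eventually_all_finset]
    intro q hq
    by_cases hpq : p = q
    · simp [hpq]
    · filter_upwards [((hφ p hp).prodMk_nhds (hφ q hq)).eventually
        (isClosed_diagonal.isOpen_compl.mem_nhds hpq)] with lam hlam _
      exact hlam
  have h3 : ∀ᶠ lam in F, ∀ x ∈ C lam, ∃ p ∈ P, φ p lam = x := by
    by_contra hcon
    rw [Filter.not_eventually] at hcon
    let B : Set (Λ × X) := {z | z.2 ∈ C z.1 ∧ ∀ p ∈ P, φ p z.1 ≠ z.2}
    have hB : (comap Prod.fst F ⊓ 𝓟 B).NeBot := by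
      rw [← Filter.frequently_mem_iff_neBot, Filter.frequently_comap]
      refine hcon.mono fun lam hlam => ?_
      push Not at hlam
      obtain ⟨x, hx, hxp⟩ := hlam
      exact ⟨(lam, x), rfl, hx, hxp⟩
    let 𝒰 := Ultrafilter.of (comap Prod.fst F ⊓ 𝓟 B)
    have hle : (𝒰 : Filter (Λ × X)) ≤ comap Prod.fst F ⊓ 𝓟 B := Ultrafilter.of_le _
    have hfst : Tendsto Prod.fst (𝒰 : Filter (Λ × X)) F :=
      tendsto_comap.mono_left (hle.trans inf_le_left)
    have hmem : ∀ᶠ z in (𝒰 : Filter (Λ × X)), z ∈ B :=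
      (hle.trans inf_le_right) (mem_principal_self B)
    obtain ⟨p, hp, hlim⟩ := hesc 𝒰 hfst (hmem.mono fun z hz => hz.1)
    have := (hfst.prodMk hlim).eventually (hloc p hp)
    obtain ⟨z, hz1, hz2⟩ := (hmem.and this).exists
    exact hz1.2 p hp (hz2.1 hz1.1)
  filter_upwards [h1, h2, h3] with lam h1 h2 h3
  have himage : C lam = ↑(P.image fun p => φ p lam) := by
    ext x
    simp only [Finset.coe_image, Set.mem_image, Finset.mem_coe]
    exact ⟨h3 x, fun ⟨p, hp, hx⟩ => hx ▸ h1 p hp⟩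
  rw [himage, Nat.card_coe_set_eq, Set.ncard_coe_finset, Finset.card_image_of_injOn]
  intro p hp q hq hpq
  by_contra hne
  exact h2 p hp q hq hne hpq

theorem sum_eq_zero_of_tendsto_critSet {c : ι → V →L[ℂ] ℂ} {d : ι → ℂ}
    {F : Filter ((ι → ℂ) × V)} [F.NeBot] {lam0 : ι → ℂ} {p : V}
    (hlam : Tendsto Prod.fst F (𝓝 lam0)) (hp : Tendsto Prod.snd F (𝓝 p))
    (hcrit : ∀ᶠ z in F, z.2 ∈ critSet c d z.1) :
    ∑ i with c i p + d i = 0, lam0 i = 0 := by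
  have hlim : ∀ i, Tendsto (fun z : (ι → ℂ) × V => z.1 i * (c i z.2 + d i)⁻¹ * c i (z.2 - p)) F
      (𝓝 (if c i p + d i = 0 then lam0 i else 0)) := by
    intro i
    have hl : Tendsto (fun z : (ι → ℂ) × V => z.1 i) F (𝓝 (lam0 i)) :=
      ((continuous_apply i).tendsto lam0).comp hlam
    split_ifs with hi
    · refine hl.congr' ?_
      filter_upwards [hcrit] with z hz
      have h1 : c i (z.2 - p) = c i z.2 + d i := by
        rw [map_sub, eq_neg_of_add_eq_zero_left hi]
        ring
      rw [h1, mul_assoc, inv_mul_cancel₀ (hz.1 i), mul_one]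
    · have h1 : Tendsto (fun z : (ι → ℂ) × V => (c i z.2 + d i)⁻¹) F (𝓝 (c i p + d i)⁻¹) :=
        ((((c i).continuous.tendsto p).comp hp).add_const _).inv₀ hi
      have h2 : Tendsto (fun z : (ι → ℂ) × V => c i (z.2 - p)) F (𝓝 (c i (p - p))) :=
        ((c i).continuous.tendsto _).comp (hp.sub_const p)
      simpa using (hl.mul h1).mul h2
  have hsum := tendsto_finsetSum Finset.univ fun i _ => hlim i
  rw [Finset.sum_filter]
  refine tendsto_nhds_unique hsum (tendsto_const_nhds.congr' ?_)
  filter_upwards [hcrit] with z hz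
  have := congrArg (fun α : V →L[ℂ] ℂ => α (z.2 - p)) hz.2
  simpa [logForm] using this.symm

/-- Critical points can escape to infinity only along a direction `y` for which the weights of
the hyperplanes not parallel to `y` add up to zero. -/
theorem tendsto_or_sum_eq_zero_of_critSet [FiniteDimensional ℂ V] {c : ι → V →L[ℂ] ℂ} {d : ι → ℂ}
    {𝒰 : Ultrafilter ((ι → ℂ) × V)} {lam0 : ι → ℂ}
    (hlam : Tendsto Prod.fst (𝒰 : Filter ((ι → ℂ) × V)) (𝓝 lam0))
    (hcrit : ∀ᶠ z in (𝒰 : Filter ((ι → ℂ) × V)), z.2 ∈ critSet c d z.1) :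
    (∃ p, Tendsto Prod.snd (𝒰 : Filter ((ι → ℂ) × V)) (𝓝 p)) ∨
      ∃ y ≠ 0, ∑ i with c i y ≠ 0, lam0 i = 0 := by
  have := FiniteDimensional.proper ℂ V
  by_cases hb : ∃ R : ℝ, ∀ᶠ z in (𝒰 : Filter ((ι → ℂ) × V)), ‖z.2‖ ≤ R
  · left
    obtain ⟨R, hR⟩ := hb
    obtain ⟨p, -, hp⟩ := (isCompact_closedBall (0 : V) R).ultrafilter_le_nhds'
      (𝒰.map Prod.snd) (by
        rw [Ultrafilter.mem_map, ← Ultrafilter.mem_coe]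
        filter_upwards [hR] with z hz
        simpa using hz)
    exact ⟨p, hp⟩
  right
  push Not at hb
  have hinf : Tendsto (fun z : (ι → ℂ) × V => ‖z.2‖) 𝒰 atTop := by
    rw [tendsto_atTop]
    intro R
    exact (hb R).mono fun z hz => hz.le
  obtain ⟨y, hy, hlim⟩ := (isCompact_sphere (0 : V) 1).ultrafilter_le_nhds'
    (𝒰.map fun z => (‖z.2‖⁻¹ : ℂ) • z.2) (by
      rw [Ultrafilter.mem_map, ← Ultrafilter.mem_coe]
      filter_upwards [hinf.eventually_gt_atTop 0] with z hz
      simp [norm_smul, hz.ne'])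
  replace hlim : Tendsto (fun z : (ι → ℂ) × V => (‖z.2‖⁻¹ : ℂ) • z.2) 𝒰 (𝓝 y) := hlim
  refine ⟨y, by rintro rfl; simp at hy, ?_⟩
  have hinv : Tendsto (fun z : (ι → ℂ) × V => (‖z.2‖ : ℂ)⁻¹) 𝒰 (𝓝 0) := by
    have h1 := (Complex.continuous_ofReal.tendsto 0).comp (tendsto_inv_atTop_zero.comp hinf)
    simpa [Function.comp_def] using h1
  have hterm : ∀ i, Tendsto
      (fun z : (ι → ℂ) × V => z.1 i * (‖z.2‖ * (c i z.2 + d i)⁻¹) * c i y) 𝒰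
      (𝓝 (if c i y ≠ 0 then lam0 i else 0)) := by
    intro i
    have hl : Tendsto (fun z : (ι → ℂ) × V => z.1 i) 𝒰 (𝓝 (lam0 i)) :=
      ((continuous_apply i).tendsto lam0).comp hlam
    split_ifs with hi
    · have h1 : Tendsto (fun z : (ι → ℂ) × V => (‖z.2‖ : ℂ) * (c i z.2 + d i)⁻¹) 𝒰
          (𝓝 (c i y)⁻¹) := by
        have h2 := (((c i).continuous.tendsto y).comp hlim).add (hinv.mul_const (d i))
        rw [zero_mul, add_zero] at h2
        refine (h2.inv₀ hi).congr fun z => ?_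
        simp only [Function.comp_apply, map_smul, smul_eq_mul]
        rw [← mul_add, mul_inv, inv_inv]
      have h3 := (hl.mul h1).mul_const (c i y)
      rwa [mul_assoc, inv_mul_cancel₀ hi, mul_one] at h3
    · rw [not_not] at hi
      simp [hi]
  have hsum := tendsto_finsetSum Finset.univ fun i _ => hterm i
  rw [Finset.sum_filter]
  refine tendsto_nhds_unique hsum (tendsto_const_nhds.congr' ?_)
  filter_upwards [hcrit] with z hz
  have := congrArg (fun α : V →L[ℂ] ℂ => (‖z.2‖ : ℂ) * α y) hz.2
  simp only [logForm, sum_apply, smul_apply, smul_eq_mul, zero_apply, mul_zero,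
    Finset.mul_sum] at this
  rw [← this]
  refine Finset.sum_congr rfl fun i _ => ?_
  ring

theorem exists_implicit_critical [FiniteDimensional ℂ V] {c : ι → V →L[ℂ] ℂ} {d lam0 : ι → ℂ}
    {p : V} (hp : p ∈ critSet c d lam0) (hnd : ∀ v, logHess c d lam0 p v = 0 → v = 0) :
    ∃ φ : (ι → ℂ) → V, Tendsto φ (𝓝 lam0) (𝓝 p) ∧
      ∀ᶠ z in 𝓝 (lam0, p), z.2 ∈ critSet c d z.1 ↔ φ z.1 = z.2 := by
  obtain ⟨φ, hφ, hloc⟩ := exists_implicit_zero (G := fun z => logForm c d z.1 z.2)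
    (contDiffAt_logForm (z := (lam0, p)) hp.1) hp.2 (hasFDerivAt_logForm lam0 hp.1) hnd
  have hne : ∀ᶠ z : (ι → ℂ) × V in 𝓝 (lam0, p), ∀ i, c i z.2 + d i ≠ 0 := by
    rw [eventually_all]
    intro i
    have hcont : Continuous fun z : (ι → ℂ) × V => c i z.2 + d i := by fun_prop
    exact hcont.continuousAt.eventually_ne (hp.1 i)
  refine ⟨φ, hφ, ?_⟩
  filter_upwards [hloc, hne] with z hz hzne
  rw [← hz]
  exact ⟨fun h => h.2, fun h => ⟨hzne, h⟩⟩

theorem logForm_eq_zero_of_tendsto {c : ι → V →L[ℂ] ℂ} {d : ι → ℂ}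
    {F : Filter ((ι → ℂ) × V)} [F.NeBot] {lam0 : ι → ℂ} {p : V}
    (hlam : Tendsto Prod.fst F (𝓝 lam0)) (hp : Tendsto Prod.snd F (𝓝 p))
    (hne : ∀ i, c i p + d i ≠ 0) {W : Type} [NormedAddCommGroup W] [NormedSpace ℂ W]
    (j : W →L[ℂ] V) (hcrit : ∀ᶠ z in F, (logForm c d z.1 z.2).comp j = 0) :
    (logForm c d lam0 p).comp j = 0 := by
  have h1 : Tendsto (fun z : (ι → ℂ) × V => logForm c d z.1 z.2) F (𝓝 (logForm c d lam0 p)) :=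
    (contDiffAt_logForm (z := (lam0, p)) hne).continuousAt.tendsto.comp
      (by rw [nhds_prod_eq]; exact hlam.prodMk hp)
  ext w
  have h2 : Tendsto (fun z : (ι → ℂ) × V => logForm c d z.1 z.2 (j w)) F
      (𝓝 (logForm c d lam0 p (j w))) :=
    ((ContinuousLinearMap.apply ℂ ℂ (j w)).continuous.tendsto _).comp h1
  refine tendsto_nhds_unique h2 (tendsto_const_nhds.congr' ?_)
  filter_upwards [hcrit] with z hz
  exact (DFunLike.congr_fun hz w).symm

/-- The weights attached to any nonempty set of indices do not cancel. -/
def IsNonresonant (lam : ι → ℂ) : Prop := ∀ J : Finset ι, J.Nonempty → ∑ i ∈ J, lam i ≠ 0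

theorem exists_tendsto_critSet [FiniteDimensional ℂ V] {c : ι → V →L[ℂ] ℂ} {d lam0 : ι → ℂ}
    (hc : IsEssential c) (hlam0 : IsNonresonant lam0) {𝒰 : Ultrafilter ((ι → ℂ) × V)}
    (hlam : Tendsto Prod.fst (𝒰 : Filter ((ι → ℂ) × V)) (𝓝 lam0))
    (hcrit : ∀ᶠ z in (𝒰 : Filter ((ι → ℂ) × V)), z.2 ∈ critSet c d z.1) :
    ∃ p ∈ critSet c d lam0, Tendsto Prod.snd (𝒰 : Filter ((ι → ℂ) × V)) (𝓝 p) := by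
  obtain ⟨p, hp⟩ | ⟨y, hy, hsum⟩ := tendsto_or_sum_eq_zero_of_critSet hlam hcrit
  · have hne : ∀ i, c i p + d i ≠ 0 := by
      intro i hi
      exact hlam0 _ ⟨i, by simpa using hi⟩ (sum_eq_zero_of_tendsto_critSet hlam hp hcrit)
    refine ⟨p, ⟨hne, ?_⟩, hp⟩
    have := logForm_eq_zero_of_tendsto hlam hp hne (ContinuousLinearMap.id ℂ V)
      (hcrit.mono fun z hz => by rw [hz.2]; rfl)
    simpa using this
  · refine (hlam0 _ ?_ hsum).elim
    by_contra hempty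
    refine hy (hc y fun i => ?_)
    by_contra hi
    exact hempty ⟨i, by simpa using hi⟩

theorem finite_critSet [FiniteDimensional ℂ V] {c : ι → V →L[ℂ] ℂ} {d lam0 : ι → ℂ}
    (hc : IsEssential c) (hlam0 : IsNonresonant lam0)
    (hnd : ∀ p ∈ critSet c d lam0, ∀ v, logHess c d lam0 p v = 0 → v = 0) :
    (critSet c d lam0).Finite := by
  by_contra hinf
  have : Infinite (critSet c d lam0) := Set.infinite_coe_iff.2 hinf
  let 𝒰 : Ultrafilter ((ι → ℂ) × V) :=
    (hyperfilter (critSet c d lam0)).map fun x : critSet c d lam0 => (lam0, (x : V))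
  have hlam : Tendsto Prod.fst (𝒰 : Filter ((ι → ℂ) × V)) (𝓝 lam0) := by
    rw [Ultrafilter.coe_map, tendsto_map'_iff]
    exact tendsto_const_nhds
  have hcrit : ∀ᶠ z in (𝒰 : Filter ((ι → ℂ) × V)), z.2 ∈ critSet c d z.1 := by
    rw [Ultrafilter.coe_map, eventually_map]
    exact Eventually.of_forall fun x => x.2
  obtain ⟨p, hp, hlim⟩ := exists_tendsto_critSet hc hlam0 hlam hcrit
  obtain ⟨φ, -, hloc⟩ := exists_implicit_critical hp (hnd p hp)
  rw [nhds_prod_eq] at hloc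
  have h1 := (hlam.prodMk hlim).eventually hloc
  rw [Ultrafilter.coe_map, eventually_map] at h1
  obtain ⟨x, hx⟩ := h1.exists
  have h2 : ∀ᶠ y in (hyperfilter (critSet c d lam0) : Filter (critSet c d lam0)), y ≠ x :=
    (Set.finite_singleton x).compl_mem_hyperfilter
  obtain ⟨y, hy, hyx⟩ := (h1.and h2).exists
  exact hyx (Subtype.ext (((hy.1 y.2).symm.trans (hx.1 x.2))))

theorem eventually_natCard_critSet [FiniteDimensional ℂ V] {c : ι → V →L[ℂ] ℂ} {d lam0 : ι → ℂ}
    (hc : IsEssential c) (hlam0 : IsNonresonant lam0)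
    (hnd : ∀ p ∈ critSet c d lam0, ∀ v, logHess c d lam0 p v = 0 → v = 0) :
    ∀ᶠ lam in 𝓝 lam0, Nat.card (critSet c d lam) = Nat.card (critSet c d lam0) := by
  have hfin := finite_critSet hc hlam0 hnd
  have hφ : ∀ p, ∃ φ : (ι → ℂ) → V, p ∈ critSet c d lam0 → (Tendsto φ (𝓝 lam0) (𝓝 p) ∧
      ∀ᶠ z in 𝓝 (lam0, p), z.2 ∈ critSet c d z.1 ↔ φ z.1 = z.2) := by
    intro p
    by_cases hp : p ∈ critSet c d lam0
    · obtain ⟨φ, h⟩ := exists_implicit_critical hp (hnd p hp)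
      exact ⟨φ, fun _ => h⟩
    · exact ⟨fun _ => p, fun h => (hp h).elim⟩
  choose φ hφ using hφ
  have hcard : Nat.card (critSet c d lam0) = hfin.toFinset.card := by
    rw [Nat.card_coe_set_eq, Set.ncard_eq_toFinset_card _ hfin]
  rw [hcard]
  refine eventually_natCard_eq (φ := φ) ?_ ?_ ?_
  · intro p hp
    exact (hφ p (hfin.mem_toFinset.1 hp)).1
  · intro p hp
    rw [← nhds_prod_eq]
    exact (hφ p (hfin.mem_toFinset.1 hp)).2
  · intro 𝒰 h1 h2
    obtain ⟨p, hp, hlim⟩ := exists_tendsto_critSet hc hlam0 h1 h2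
    exact ⟨p, hfin.mem_toFinset.2 hp, hlim⟩

theorem clm_zero_smul {E F : Type} [NormedAddCommGroup E] [NormedSpace ℂ E]
    [NormedAddCommGroup F] [NormedSpace ℂ F] (f : E →L[ℂ] F) : (0 : ℂ) • f = 0 := by
  ext
  simp

theorem clm_add_smul {E F : Type} [NormedAddCommGroup E] [NormedSpace ℂ E]
    [NormedAddCommGroup F] [NormedSpace ℂ F] (a b : ℂ) (f : E →L[ℂ] F) :
    (a + b) • f = a • f + b • f := by
  ext
  simp [add_smul]

/-- Deletion: the linear part at `h` is replaced by `0`. -/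
noncomputable def delLin (c : ι → V →L[ℂ] ℂ) (h : ι) : ι → V →L[ℂ] ℂ := Function.update c h 0

/-- Deletion: the constant term at `h` is replaced by `1`. -/
noncomputable def delConst (d : ι → ℂ) (h : ι) : ι → ℂ := Function.update d h 1

/-- The direction of the hyperplane indexed by `h`. -/
noncomputable abbrev hyperDir (c : ι → V →L[ℂ] ℂ) (h : ι) : Submodule ℂ V :=
  LinearMap.ker (c h).toLinearMap

/-- Restriction to the hyperplane indexed by `h`: linear parts. -/
noncomputable def resLin (c : ι → V →L[ℂ] ℂ) (h : ι) : ι → hyperDir c h →L[ℂ] ℂ :=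
  fun i => (c i).comp (hyperDir c h).subtypeL

/-- Restriction to the hyperplane through `p` indexed by `h`: constant terms. -/
noncomputable def resConst (c : ι → V →L[ℂ] ℂ) (d : ι → ℂ) (h : ι) (p : V) : ι → ℂ :=
  Function.update (fun i => c i p + d i) h 1

theorem del_apply_ne_zero_iff {ι : Type} {c : ι → V →L[ℂ] ℂ} {d : ι → ℂ} {h : ι} {x : V} :
    (∀ i, delLin c h i x + delConst d h i ≠ 0) ↔ ∀ i ≠ h, c i x + d i ≠ 0 := by
  refine forall_congr' fun i => ?_
  by_cases hi : i = h
  · subst hi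
    simp [delLin, delConst]
  · simp [delLin, delConst, hi]

theorem res_apply_ne_zero_iff {ι : Type} {c : ι → V →L[ℂ] ℂ} {d : ι → ℂ} {h : ι} {p : V}
    {w : hyperDir c h} :
    (∀ i, resLin c h i w + resConst c d h p i ≠ 0) ↔ ∀ i ≠ h, c i (p + w) + d i ≠ 0 := by
  refine forall_congr' fun i => ?_
  by_cases hi : i = h
  · subst hi
    simp [resLin, resConst]
  · simp only [resLin, resConst, ne_eq, hi, not_false_eq_true, Function.update_of_ne, map_add,
      forall_const, ContinuousLinearMap.comp_apply, Submodule.subtypeL_apply]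
    rw [← add_assoc, add_comm (c i w)]

theorem logForm_eq_del_add (c : ι → V →L[ℂ] ℂ) (d lam : ι → ℂ) (h : ι) (x : V) :
    logForm c d lam x =
      logForm (delLin c h) (delConst d h) lam x + (lam h * (c h x + d h)⁻¹) • c h := by
  unfold logForm
  rw [← Finset.add_sum_erase _ _ (Finset.mem_univ h), ← Finset.add_sum_erase Finset.univ
    (fun i => (lam i * (delLin c h i x + delConst d h i)⁻¹) • delLin c h i) (Finset.mem_univ h)]
  have : ∀ i ∈ Finset.univ.erase h, (lam i * (delLin c h i x + delConst d h i)⁻¹) • delLin c h i =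
      (lam i * (c i x + d i)⁻¹) • c i := by
    intro i hi
    simp [delLin, delConst, Finset.ne_of_mem_erase hi]
  have hh : (lam h * (delLin c h h x + delConst d h h)⁻¹) • delLin c h h = 0 := by
    ext
    simp [delLin]
  rw [Finset.sum_congr rfl this, hh, zero_add, add_comm]

theorem logHess_eq_del {c : ι → V →L[ℂ] ℂ} {lam : ι → ℂ} {h : ι} (hh : lam h = 0) (d : ι → ℂ)
    (x : V) : logHess c d lam x = logHess (delLin c h) (delConst d h) lam x := by
  unfold logHess
  refine Finset.sum_congr rfl fun i _ => ?_
  by_cases hi : i = h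
  · subst hi
    simp only [hh, zero_mul, neg_zero, clm_zero_smul]
  · simp [delLin, delConst, hi]

theorem logForm_res (c : ι → V →L[ℂ] ℂ) (d lam : ι → ℂ) (h : ι) (p : V) (w : hyperDir c h) :
    logForm (resLin c h) (resConst c d h p) lam w =
      (logForm (delLin c h) (delConst d h) lam (p + w)).comp (hyperDir c h).subtypeL := by
  ext v
  simp only [logForm, sum_apply, smul_apply, ContinuousLinearMap.comp_apply]
  refine Finset.sum_congr rfl fun i _ => ?_
  by_cases hi : i = h
  · subst hi
    have : c i v = 0 := v.2
    simp [resLin, delLin, this]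
  · simp only [resLin, resConst, delLin, delConst, ne_eq, hi, not_false_eq_true,
      Function.update_of_ne, map_add, ContinuousLinearMap.comp_apply, Submodule.subtypeL_apply]
    rw [← add_assoc, add_comm (c i w)]

theorem logHess_res (c : ι → V →L[ℂ] ℂ) (d lam : ι → ℂ) (h : ι) (p : V) (w v : hyperDir c h) :
    logHess (resLin c h) (resConst c d h p) lam w v =
      (logHess (delLin c h) (delConst d h) lam (p + w) v).comp (hyperDir c h).subtypeL := by
  ext u
  simp only [logHess, sum_apply, smul_apply, ContinuousLinearMap.comp_apply]
  refine Finset.sum_congr rfl fun i _ => ?_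
  by_cases hi : i = h
  · subst hi
    simp [resLin, delLin]
  · simp only [resLin, resConst, delLin, delConst, ne_eq, hi, not_false_eq_true,
      Function.update_of_ne, map_add, ContinuousLinearMap.comp_apply, Submodule.subtypeL_apply,
      ContinuousLinearMap.smulRight_apply, smul_apply]
    rw [← add_assoc, add_comm (c i w)]

/-- Near a critical point of the restriction to the hyperplane of index `h`, and for weights near
a weight vanishing at `h`, there is a unique critical point of the full arrangement. -/
theorem exists_implicit_critical_of_res [FiniteDimensional ℂ V] {c : ι → V →L[ℂ] ℂ}
    {d lam0 : ι → ℂ} {h : ι} {v0 p0 : V} (hv0 : c h v0 = 1) (hp0 : c h p0 + d h = 0)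
    (hlamh : lam0 h = 0) {w0 : hyperDir c h}
    (hw0 : w0 ∈ critSet (resLin c h) (resConst c d h p0) lam0)
    (hnd : ∀ v, logHess (resLin c h) (resConst c d h p0) lam0 w0 v = 0 → v = 0)
    (havoid : ∀ x ∈ critSet (delLin c h) (delConst d h) lam0, c h x + d h ≠ 0) :
    ∃ φ : (ι → ℂ) → V, Tendsto φ (𝓝 lam0) (𝓝 (p0 + w0)) ∧
      ∀ᶠ z in 𝓝 (lam0, p0 + (w0 : V)), z.1 h ≠ 0 → (z.2 ∈ critSet c d z.1 ↔ φ z.1 = z.2) := by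
  set p : V := p0 + w0 with hpdef
  have hfp : c h p + d h = 0 := by
    have : c h w0 = 0 := w0.2
    rw [hpdef, map_add, this, add_zero, hp0]
  have hne : ∀ i, delLin c h i p + delConst d h i ≠ 0 :=
    del_apply_ne_zero_iff.2 (res_apply_ne_zero_iff.1 hw0.1)
  let R : (ι → ℂ) → V → V →L[ℂ] ℂ := logForm (delLin c h) (delConst d h)
  let π : V →L[ℂ] V := ContinuousLinearMap.id ℂ V - (c h).smulRight v0
  have hπ : ∀ v, π v = v - c h v • v0 := fun v => rfl
  have hπ0 : π v0 = 0 := by rw [hπ, hv0, one_smul, sub_self]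
  have hπmem : ∀ v, π v ∈ hyperDir c h := by
    intro v
    simp [hπ, hv0]
  have hdecomp : ∀ (α : V →L[ℂ] ℂ), α = α.comp π + α v0 • c h := by
    intro α
    ext v
    simp [hπ, mul_comm]
  let G : (ι → ℂ) × V → V →L[ℂ] ℂ := fun z =>
    (R z.1 z.2).comp π + (z.1 h + (c h z.2 + d h) * R z.1 z.2 v0) • c h
  have hRp : (R lam0 p).comp π = 0 := by
    ext v
    have h1 := hw0.2
    rw [logForm_res] at h1
    exact DFunLike.congr_fun h1 ⟨π v, hπmem v⟩
  have hRv0 : R lam0 p v0 ≠ 0 := by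
    intro h0
    refine havoid p ⟨hne, ?_⟩ hfp
    have := hdecomp (R lam0 p)
    rwa [hRp, h0, clm_zero_smul, add_zero] at this
  have hRsmooth : ContDiffAt ℂ 1 (fun z : (ι → ℂ) × V => R z.1 z.2) (lam0, p) :=
    contDiffAt_logForm (z := (lam0, p)) hne
  have hGsmooth : ContDiffAt ℂ 1 G (lam0, p) := by
    have h1 : ContDiffAt ℂ 1 (fun z : (ι → ℂ) × V => (R z.1 z.2).comp π) (lam0, p) :=
      ((ContinuousLinearMap.compL ℂ V V ℂ).flip π).contDiff.contDiffAt.comp (lam0, p) hRsmooth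
    have h2 : ContDiffAt ℂ 1 (fun z : (ι → ℂ) × V => R z.1 z.2 v0) (lam0, p) :=
      (ContinuousLinearMap.apply ℂ ℂ v0).contDiff.contDiffAt.comp (lam0, p) hRsmooth
    have h3 : ContDiffAt ℂ 1 (fun z : (ι → ℂ) × V => c h z.2 + d h) (lam0, p) := by fun_prop
    have h4 : ContDiffAt ℂ 1 (fun z : (ι → ℂ) × V => z.1 h) (lam0, p) := by fun_prop
    exact h1.add ((h4.add (h3.mul h2)).smul contDiffAt_const)
  have hG0 : G (lam0, p) = 0 := by
    simp only [G, hRp, hlamh, hfp, zero_mul, add_zero, clm_zero_smul]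
  have hRder : HasFDerivAt (R lam0) (logHess (delLin c h) (delConst d h) lam0 p) p :=
    hasFDerivAt_logForm lam0 hne
  have hGder := ((((ContinuousLinearMap.compL ℂ V V ℂ).flip π).hasFDerivAt.comp p hRder)).add
    (((((c h).hasFDerivAt (x := p)).add_const (d h)).mul
      (((ContinuousLinearMap.apply ℂ ℂ v0).hasFDerivAt (x := R lam0 p)).comp p hRder)).const_add
        (lam0 h) |>.smul_const (c h))
  obtain ⟨φ, hφ, hloc⟩ := exists_implicit_zero (G := G) hGsmooth hG0 hGder (by
    intro v hv
    have hv' : ∀ u, logHess (delLin c h) (delConst d h) lam0 p v (π u) +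
        (R lam0 p v0 * c h v) * c h u = 0 := by
      intro u
      have := DFunLike.congr_fun hv u
      simpa [hfp, mul_comm] using this
    have hcv : c h v = 0 := by
      have := hv' v0
      rw [hπ0, map_zero, zero_add, hv0, mul_one] at this
      exact (mul_eq_zero.1 this).resolve_left hRv0
    have := hnd ⟨v, hcv⟩ (by
      rw [logHess_res]
      ext u
      have h1 := hv' u
      have h2 : π (u : V) = u := by
        have : c h u = 0 := u.2
        rw [hπ, this, zero_smul, sub_zero]
      rw [h2, hcv, mul_zero, zero_mul, add_zero] at h1
      exact h1)
    exact congrArg Subtype.val this)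
  have hnear : ∀ᶠ z : (ι → ℂ) × V in 𝓝 (lam0, p), ∀ i, delLin c h i z.2 + delConst d h i ≠ 0 := by
    rw [eventually_all]
    intro i
    have hcont : Continuous fun z : (ι → ℂ) × V => delLin c h i z.2 + delConst d h i := by fun_prop
    exact hcont.continuousAt.eventually_ne (hne i)
  refine ⟨φ, hφ, ?_⟩
  filter_upwards [hloc, hnear] with z hz hzne hzh
  rw [← hz]
  have hzne' := del_apply_ne_zero_iff.1 hzne
  have hsplit : logForm c d z.1 z.2 = (R z.1 z.2).comp π +
      (R z.1 z.2 v0 + z.1 h * (c h z.2 + d h)⁻¹) • c h := by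
    rw [logForm_eq_del_add c d z.1 h z.2, clm_add_smul, ← add_assoc, ← hdecomp]
  have hcoef : ∀ (α : V →L[ℂ] ℂ) (a : ℂ), α.comp π + a • c h = 0 ↔ α.comp π = 0 ∧ a = 0 := by
    intro α a
    constructor
    · intro h0
      have ha : a = 0 := by
        have := DFunLike.congr_fun h0 v0
        simpa [hπ0, hv0] using this
      refine ⟨?_, ha⟩
      rwa [ha, clm_zero_smul, add_zero] at h0
    · rintro ⟨h1, h2⟩
      rw [h1, h2, clm_zero_smul, add_zero]
  constructor
  · rintro ⟨hx, hcrit⟩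
    rw [hsplit, hcoef] at hcrit
    refine (hcoef _ _).2 ⟨hcrit.1, ?_⟩
    have hxh := hx h
    have h2 := hcrit.2
    field_simp at h2
    linear_combination h2
  · intro hGz
    obtain ⟨h1, h2⟩ := (hcoef _ _).1 hGz
    have hxh : c h z.2 + d h ≠ 0 := by
      intro h0
      rw [h0, zero_mul, add_zero] at h2
      exact hzh h2
    refine ⟨fun i => ?_, ?_⟩
    · by_cases hi : i = h
      · exact hi ▸ hxh
      · exact hzne' i hi
    · rw [hsplit, hcoef]
      refine ⟨h1, ?_⟩
      field_simp
      linear_combination h2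

/-- When the weight of index `h` tends to `0` along nonzero values, every critical point converges
to a critical point of the deletion or of the restriction. -/
theorem exists_tendsto_critSet_degenerate [FiniteDimensional ℂ V] {c : ι → V →L[ℂ] ℂ}
    {d lam0 : ι → ℂ} {h : ι} {p0 : V} (hp0 : c h p0 + d h = 0) (hlamh : lam0 h = 0)
    (hres : ∀ J : Finset ι, ∑ i ∈ J, lam0 i = 0 → J ⊆ {h}) (hc : IsEssential (delLin c h))
    {𝒰 : Ultrafilter ((ι → ℂ) × V)}
    (hlam : Tendsto Prod.fst (𝒰 : Filter ((ι → ℂ) × V)) (𝓝 lam0))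
    (hcrit : ∀ᶠ z in (𝒰 : Filter ((ι → ℂ) × V)), z.2 ∈ critSet c d z.1) :
    ∃ p, Tendsto Prod.snd (𝒰 : Filter ((ι → ℂ) × V)) (𝓝 p) ∧
      (p ∈ critSet (delLin c h) (delConst d h) lam0 ∨
        ∃ w ∈ critSet (resLin c h) (resConst c d h p0) lam0, p0 + (w : V) = p) := by
  obtain ⟨p, hp⟩ | ⟨y, hy, hsum⟩ := tendsto_or_sum_eq_zero_of_critSet hlam hcrit
  · refine ⟨p, hp, ?_⟩
    have hzero := hres _ (sum_eq_zero_of_tendsto_critSet hlam hp hcrit)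
    have hne : ∀ i ≠ h, c i p + d i ≠ 0 := fun i hi h0 =>
      hi (Finset.mem_singleton.1 (hzero (by simpa using h0)))
    by_cases hfp : c h p + d h = 0
    · right
      refine ⟨⟨p - p0, ?_⟩, ⟨res_apply_ne_zero_iff.2 ?_, ?_⟩, by simp⟩
      · rw [LinearMap.mem_ker, ContinuousLinearMap.coe_coe, map_sub]
        linear_combination hfp - hp0
      · simpa using hne
      · rw [logForm_res]
        simp only [add_sub_cancel]
        refine logForm_eq_zero_of_tendsto hlam hp (del_apply_ne_zero_iff.2 hne) _ ?_
        filter_upwards [hcrit] with z hz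
        ext v
        have h1 := DFunLike.congr_fun hz.2 (v : V)
        have h2 : c h v = 0 := v.2
        rw [logForm_eq_del_add c d z.1 h z.2] at h1
        simpa [h2] using h1
    · left
      refine ⟨del_apply_ne_zero_iff.2 hne, ?_⟩
      have hne' : ∀ i, c i p + d i ≠ 0 := fun i => by
        by_cases hi : i = h
        · exact hi ▸ hfp
        · exact hne i hi
      have h1 := logForm_eq_zero_of_tendsto hlam hp hne' (ContinuousLinearMap.id ℂ V) (by
        filter_upwards [hcrit] with z hz
        rw [hz.2, ContinuousLinearMap.zero_comp])
      rwa [ContinuousLinearMap.comp_id, logForm_eq_del_add c d lam0 h p, hlamh, zero_mul,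
        clm_zero_smul, add_zero] at h1
  · refine absurd (hc y fun i => ?_) hy
    by_cases hi : i = h
    · simp [delLin, hi]
    · rw [delLin, Function.update_of_ne hi]
      by_contra h0
      exact hi (Finset.mem_singleton.1 (hres _ hsum (by simpa using h0)))

theorem eventually_natCard_degenerate [FiniteDimensional ℂ V] {c : ι → V →L[ℂ] ℂ}
    {d lam0 : ι → ℂ} {h : ι} {v0 p0 : V} (hv0 : c h v0 = 1) (hp0 : c h p0 + d h = 0)
    (hlamh : lam0 h = 0) (hres : ∀ J : Finset ι, ∑ i ∈ J, lam0 i = 0 → J ⊆ {h})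
    (hc : IsEssential (delLin c h))
    (hfin' : (critSet (delLin c h) (delConst d h) lam0).Finite)
    (hnd' : ∀ p ∈ critSet (delLin c h) (delConst d h) lam0, ∀ v,
      logHess (delLin c h) (delConst d h) lam0 p v = 0 → v = 0)
    (havoid : ∀ x ∈ critSet (delLin c h) (delConst d h) lam0, c h x + d h ≠ 0)
    (hfin'' : (critSet (resLin c h) (resConst c d h p0) lam0).Finite)
    (hnd'' : ∀ p ∈ critSet (resLin c h) (resConst c d h p0) lam0, ∀ v,
      logHess (resLin c h) (resConst c d h p0) lam0 p v = 0 → v = 0) :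
    ∀ᶠ lam in 𝓝[{lam | lam h ≠ 0}] lam0, Nat.card (critSet c d lam) =
      Nat.card (critSet (delLin c h) (delConst d h) lam0) +
        Nat.card (critSet (resLin c h) (resConst c d h p0) lam0) := by
  have hshift : Function.Injective fun w : hyperDir c h => p0 + (w : V) := fun w w' hw =>
    Subtype.ext (add_left_cancel hw)
  let P : Finset V := hfin'.toFinset ∪ hfin''.toFinset.image fun w : hyperDir c h => p0 + (w : V)
  have hdisj : Disjoint hfin'.toFinset
      (hfin''.toFinset.image fun w : hyperDir c h => p0 + (w : V)) := by
    rw [Finset.disjoint_left]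
    intro x hx hx'
    obtain ⟨w, -, rfl⟩ := Finset.mem_image.1 hx'
    refine havoid _ (hfin'.mem_toFinset.1 hx) ?_
    have : c h w = 0 := w.2
    rw [map_add, this, add_zero, hp0]
  have hcard : Nat.card (critSet (delLin c h) (delConst d h) lam0) +
      Nat.card (critSet (resLin c h) (resConst c d h p0) lam0) = P.card := by
    rw [Finset.card_union_of_disjoint hdisj, Finset.card_image_of_injective _ hshift,
      Nat.card_coe_set_eq, Nat.card_coe_set_eq, Set.ncard_eq_toFinset_card _ hfin',
      Set.ncard_eq_toFinset_card _ hfin'']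
  have hφ : ∀ p, ∃ φ : (ι → ℂ) → V, p ∈ P → (Tendsto φ (𝓝 lam0) (𝓝 p) ∧
      ∀ᶠ z in 𝓝 (lam0, p), z.1 h ≠ 0 → (z.2 ∈ critSet c d z.1 ↔ φ z.1 = z.2)) := by
    intro p
    by_cases hp : p ∈ P
    · rcases Finset.mem_union.1 hp with hp' | hp'
      · have hp1 := hfin'.mem_toFinset.1 hp'
        have hpc : p ∈ critSet c d lam0 := by
          refine ⟨fun i => ?_, ?_⟩
          · by_cases hi : i = h
            · exact hi ▸ havoid p hp1
            · exact del_apply_ne_zero_iff.1 hp1.1 i hi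
          · rw [logForm_eq_del_add c d lam0 h p, hp1.2, hlamh, zero_mul, clm_zero_smul, add_zero]
        obtain ⟨φ, h1, h2⟩ := exists_implicit_critical hpc (fun v hv => hnd' p hp1 v (by
          rwa [logHess_eq_del hlamh] at hv))
        exact ⟨φ, fun _ => ⟨h1, h2.mono fun z hz _ => hz⟩⟩
      · obtain ⟨w, hw, rfl⟩ := Finset.mem_image.1 hp'
        have hw' := hfin''.mem_toFinset.1 hw
        obtain ⟨φ, h1⟩ := exists_implicit_critical_of_res hv0 hp0 hlamh hw' (hnd'' w hw') havoid
        exact ⟨φ, fun _ => h1⟩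
    · exact ⟨fun _ => p, fun h => (hp h).elim⟩
  choose φ hφ using hφ
  rw [hcard]
  refine eventually_natCard_eq (φ := φ) ?_ ?_ ?_
  · intro p hp
    exact (hφ p hp).1.mono_left nhdsWithin_le_nhds
  · intro p hp
    have h1 := (hφ p hp).2
    rw [nhds_prod_eq] at h1
    have h2 : ∀ᶠ z in 𝓝[{lam : ι → ℂ | lam h ≠ 0}] lam0 ×ˢ 𝓝 p, z.1 h ≠ 0 :=
      tendsto_fst.eventually self_mem_nhdsWithin
    filter_upwards [h1.filter_mono (Filter.prod_mono_left _ nhdsWithin_le_nhds), h2] with z hz hz'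
    exact hz hz'
  · intro 𝒰 h1 h2
    obtain ⟨p, hlim, hp⟩ := exists_tendsto_critSet_degenerate hp0 hlamh hres hc
      (h1.mono_right nhdsWithin_le_nhds) h2
    refine ⟨p, ?_, hlim⟩
    rcases hp with hp | ⟨w, hw, rfl⟩
    · exact Finset.mem_union_left _ (hfin'.mem_toFinset.2 hp)
    · exact Finset.mem_union_right _ (Finset.mem_image_of_mem _ (hfin''.mem_toFinset.2 hw))

theorem finite_eval_line_eq_zero {ι : Type} {P : MvPolynomial ι ℂ} {a : ι → ℂ}
    (ha : MvPolynomial.eval a P ≠ 0) (b : ι → ℂ) :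
    {z : ℂ | MvPolynomial.eval (b + z • (a - b)) P = 0}.Finite := by
  let Q : Polynomial ℂ :=
    MvPolynomial.aeval (fun i => Polynomial.C (b i) + Polynomial.X * Polynomial.C (a i - b i)) P
  have hQ : ∀ z, Q.eval z = MvPolynomial.eval (b + z • (a - b)) P := by
    intro z
    simp only [Q]
    rw [← Polynomial.coe_evalRingHom, MvPolynomial.aeval_def, MvPolynomial.hom_eval₂,
      MvPolynomial.eval, MvPolynomial.coe_eval₂Hom]
    congr 1
    · ext x
      simp
    · ext i
      simp
  have hQ0 : Q ≠ 0 := by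
    intro h0
    refine ha ?_
    have := hQ 1
    rw [h0] at this
    simpa using this.symm
  refine (Q.roots.toFinset.finite_toSet).subset fun z hz => ?_
  rw [Finset.mem_coe, Multiset.mem_toFinset, Polynomial.mem_roots hQ0, Polynomial.IsRoot, hQ]
  exact hz

theorem isPreconnected_eval_ne_zero {ι : Type} (P : MvPolynomial ι ℂ) :
    IsPreconnected {lam : ι → ℂ | MvPolynomial.eval lam P ≠ 0} := by
  refine isPreconnected_of_forall_pair fun a ha b hb => ?_
  refine ⟨(fun z : ℂ => b + z • (a - b)) '' {z | MvPolynomial.eval (b + z • (a - b)) P = 0}ᶜ,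
    ?_, ⟨1, ?_, by simp⟩, ⟨0, ?_, by simp⟩, ?_⟩
  · rintro _ ⟨z, hz, rfl⟩
    exact hz
  · simpa using ha
  · simpa using hb
  · refine IsPreconnected.image ?_ _ (by fun_prop)
    exact ((finite_eval_line_eq_zero ha b).countable.isPathConnected_compl_of_one_lt_rank
      (by simp)).isConnected.isPreconnected

theorem dense_eval_ne_zero {ι : Type} {P : MvPolynomial ι ℂ} (hP : P ≠ 0) :
    Dense {lam : ι → ℂ | MvPolynomial.eval lam P ≠ 0} := by
  intro b
  obtain ⟨a, ha⟩ : ∃ a, MvPolynomial.eval a P ≠ 0 := by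
    by_contra! h
    exact hP (MvPolynomial.funext fun x => by simpa using h x)
  have h0 : (0 : ℂ) ∈ closure {z : ℂ | MvPolynomial.eval (b + z • (a - b)) P = 0}ᶜ :=
    (finite_eval_line_eq_zero ha b).countable.dense_compl ℂ 0
  have hcont : Continuous fun z : ℂ => b + z • (a - b) := by fun_prop
  have := map_mem_closure hcont h0 (t := {lam : ι → ℂ | MvPolynomial.eval lam P ≠ 0})
    (fun z hz => hz)
  simpa using this

/-- A polynomial whose nonvanishing locus consists of the nonresonant weights. -/
theorem exists_polynomial_isNonresonant (ι : Type) [Fintype ι] :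
    ∃ P : MvPolynomial ι ℂ, P ≠ 0 ∧ ∀ lam, MvPolynomial.eval lam P ≠ 0 → IsNonresonant lam := by
  refine ⟨∏ J : Finset ι with J.Nonempty, ∑ i ∈ J, MvPolynomial.X i, ?_, ?_⟩
  · rw [Finset.prod_ne_zero_iff]
    intro J hJ h0
    have := congrArg (MvPolynomial.eval fun _ => 1) h0
    simp only [map_sum, MvPolynomial.eval_X, map_zero, Finset.sum_const, nsmul_eq_mul,
      mul_one, Nat.cast_eq_zero, Finset.card_eq_zero] at this
    exact (Finset.mem_filter.1 hJ).2.ne_empty this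
  · intro lam hlam J hJ h0
    rw [map_prod, Finset.prod_ne_zero_iff] at hlam
    exact hlam J (by simpa using hJ) (by simpa using h0)

/-- The number of critical points is the same for all generic weights. -/
theorem exists_polynomial_natCard_const [FiniteDimensional ℂ V] {c : ι → V →L[ℂ] ℂ}
    (hc : IsEssential c) (d : ι → ℂ) :
    ∃ P : MvPolynomial ι ℂ, P ≠ 0 ∧ (∀ lam, MvPolynomial.eval lam P ≠ 0 → IsNonresonant lam ∧
      ∀ x ∈ critSet c d lam, ∀ v, logHess c d lam x v = 0 → v = 0) ∧
      ∀ lam lam', MvPolynomial.eval lam P ≠ 0 → MvPolynomial.eval lam' P ≠ 0 →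
        Nat.card (critSet c d lam) = Nat.card (critSet c d lam') := by
  obtain ⟨P, hP, hnd⟩ := exists_polynomial_nondegenerate hc d
  obtain ⟨Q, hQ, hnr⟩ := exists_polynomial_isNonresonant ι
  have hgen : ∀ lam, MvPolynomial.eval lam (P * Q) ≠ 0 → IsNonresonant lam ∧
      ∀ x ∈ critSet c d lam, ∀ v, logHess c d lam x v = 0 → v = 0 := by
    intro lam hlam
    rw [map_mul] at hlam
    exact ⟨hnr lam (right_ne_zero_of_mul hlam), hnd lam (left_ne_zero_of_mul hlam)⟩
  refine ⟨P * Q, mul_ne_zero hP hQ, hgen, fun lam lam' hlam hlam' => ?_⟩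
  refine (isPreconnected_eval_ne_zero (P * Q)).constant
    (f := fun lam => Nat.card (critSet c d lam)) (fun lam0 hlam0 => ?_) hlam hlam'
  obtain ⟨h1, h2⟩ := hgen lam0 hlam0
  refine ContinuousAt.continuousWithinAt ?_
  exact continuousAt_const.congr
    ((eventually_natCard_critSet hc h1 h2).mono fun lam h => h.symm)

theorem logForm_congr_weight {c : ι → V →L[ℂ] ℂ} {lam lam' : ι → ℂ}
    (hl : ∀ i, c i ≠ 0 → lam i = lam' i) (d : ι → ℂ) (x : V) :
    logForm c d lam x = logForm c d lam' x := by
  refine Finset.sum_congr rfl fun i _ => ?_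
  by_cases hi : c i = 0
  · ext
    simp [hi]
  · rw [hl i hi]

theorem logHess_congr_weight {c : ι → V →L[ℂ] ℂ} {lam lam' : ι → ℂ}
    (hl : ∀ i, c i ≠ 0 → lam i = lam' i) (d : ι → ℂ) (x : V) :
    logHess c d lam x = logHess c d lam' x := by
  refine Finset.sum_congr rfl fun i _ => ?_
  by_cases hi : c i = 0
  · ext
    simp [hi]
  · rw [hl i hi]

theorem critSet_congr_weight {c : ι → V →L[ℂ] ℂ} {lam lam' : ι → ℂ}
    (hl : ∀ i, c i ≠ 0 → lam i = lam' i) (d : ι → ℂ) : critSet c d lam = critSet c d lam' := by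
  ext x
  simp only [critSet, Set.mem_ofPred_eq, logForm_congr_weight hl d x]

/-- The alternating sum over the subfamilies with a common zero; for an arrangement this is the
value at `1` of the characteristic polynomial. -/
noncomputable def eulerSum (c : ι → V →L[ℂ] ℂ) (d : ι → ℂ) : ℤ :=
  ∑ S : Finset ι, if ∃ x : V, ∀ i ∈ S, c i x + d i = 0 then (-1) ^ S.card else 0

theorem sum_finset_eq_sum_erase (f : Finset ι → ℤ) (h : ι) :
    ∑ S : Finset ι, f S = ∑ T ∈ (Finset.univ.erase h).powerset, (f T + f (insert h T)) := by
  rw [Finset.sum_add_distrib, ← Finset.sum_powerset_insert (Finset.notMem_erase h _),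
    Finset.insert_erase (Finset.mem_univ h), Finset.powerset_univ]

theorem eulerSum_eq_sub {c : ι → V →L[ℂ] ℂ} {d : ι → ℂ} {h : ι} {p0 : V}
    (hp0 : c h p0 + d h = 0) :
    eulerSum c d = eulerSum (delLin c h) (delConst d h) -
      eulerSum (resLin c h) (resConst c d h p0) := by
  unfold eulerSum
  rw [sum_finset_eq_sum_erase _ h, sum_finset_eq_sum_erase _ h, sum_finset_eq_sum_erase _ h,
    ← Finset.sum_sub_distrib]
  refine Finset.sum_congr rfl fun T hT => ?_
  have hT' : h ∉ T := fun hh => Finset.notMem_erase h _ (Finset.mem_powerset.1 hT hh)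
  have hdel : (∃ x : V, ∀ i ∈ T, delLin c h i x + delConst d h i = 0) ↔
      ∃ x : V, ∀ i ∈ T, c i x + d i = 0 := by
    refine exists_congr fun x => forall₂_congr fun i hi => ?_
    have : i ≠ h := fun hh => hT' (hh ▸ hi)
    simp [delLin, delConst, this]
  have hdel' : ¬ ∃ x : V, ∀ i ∈ insert h T, delLin c h i x + delConst d h i = 0 := by
    rintro ⟨x, hx⟩
    simpa [delLin, delConst] using hx h (Finset.mem_insert_self h T)
  have hres' : ¬ ∃ x : hyperDir c h, ∀ i ∈ insert h T,
      resLin c h i x + resConst c d h p0 i = 0 := by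
    rintro ⟨x, hx⟩
    simpa [resLin, resConst] using hx h (Finset.mem_insert_self h T)
  have hres : (∃ x : hyperDir c h, ∀ i ∈ T, resLin c h i x + resConst c d h p0 i = 0) ↔
      ∃ x : V, ∀ i ∈ insert h T, c i x + d i = 0 := by
    have key : ∀ i ∈ T, ∀ x : hyperDir c h,
        resLin c h i x + resConst c d h p0 i = c i (p0 + x) + d i := by
      intro i hi x
      have : i ≠ h := fun hh => hT' (hh ▸ hi)
      simp only [resLin, resConst, ne_eq, this, not_false_eq_true, Function.update_of_ne, map_add,
        ContinuousLinearMap.comp_apply, Submodule.subtypeL_apply]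
      ring
    constructor
    · rintro ⟨x, hx⟩
      refine ⟨p0 + x, fun i hi => ?_⟩
      rcases Finset.mem_insert.1 hi with rfl | hi
      · have : c i x = 0 := x.2
        rw [map_add, this, add_zero, hp0]
      · rw [← key i hi, hx i hi]
    · rintro ⟨x, hx⟩
      have hxh := hx h (Finset.mem_insert_self h T)
      refine ⟨⟨x - p0, ?_⟩, fun i hi => ?_⟩
      · rw [LinearMap.mem_ker, ContinuousLinearMap.coe_coe, map_sub]
        linear_combination hxh - hp0
      · rw [key i hi]
        simpa using hx i (Finset.mem_insert_of_mem hi)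
  simp only [hdel, hdel', hres, hres', if_false, add_zero, Finset.card_insert_of_notMem hT',
    pow_succ]
  split_ifs <;> ring

theorem eulerSum_eq_zero {c : ι → V →L[ℂ] ℂ} {h : ι} {v : V} (hv : ∀ i ≠ h, c i v = 0)
    (hvh : c h v ≠ 0) (d : ι → ℂ) : eulerSum c d = 0 := by
  unfold eulerSum
  rw [sum_finset_eq_sum_erase _ h]
  refine Finset.sum_eq_zero fun T hT => ?_
  have hT' : h ∉ T := fun hh => Finset.notMem_erase h _ (Finset.mem_powerset.1 hT hh)
  have : (∃ x : V, ∀ i ∈ insert h T, c i x + d i = 0) ↔ ∃ x : V, ∀ i ∈ T, c i x + d i = 0 := by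
    constructor
    · rintro ⟨x, hx⟩
      exact ⟨x, fun i hi => hx i (Finset.mem_insert_of_mem hi)⟩
    · rintro ⟨x, hx⟩
      refine ⟨x - ((c h x + d h) * (c h v)⁻¹) • v, fun i hi => ?_⟩
      rcases Finset.mem_insert.1 hi with rfl | hi
      · rw [map_sub, map_smul, smul_eq_mul]
        field_simp
        ring
      · rw [map_sub, map_smul, hv i (fun hh => hT' (hh ▸ hi)), smul_zero, sub_zero, hx i hi]
  rw [if_congr this rfl rfl, Finset.card_insert_of_notMem hT', pow_succ]
  split_ifs <;> ring

theorem natCard_critSet_eq_of_forall_eq_zero {c : ι → V →L[ℂ] ℂ} (hc : IsEssential c)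
    (h0 : ∀ i, c i = 0) (d lam : ι → ℂ) :
    (Nat.card (critSet c d lam) : ℤ) = (-1) ^ Module.finrank ℂ V * eulerSum c d := by
  have hsub : Subsingleton V :=
    ⟨fun x y => (hc x fun i => by simp [h0]).trans (hc y fun i => by simp [h0]).symm⟩
  have hsum : eulerSum c d = if (Finset.univ.filter fun i => d i = 0) = ∅ then 1 else 0 := by
    rw [← Finset.sum_powerset_neg_one_pow_card, eulerSum, ← Finset.sum_filter]
    refine Finset.sum_congr ?_ fun _ _ => rfl
    ext S
    simp [h0, Finset.subset_iff]
  rw [Module.finrank_zero_of_subsingleton, pow_zero, one_mul, hsum]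
  by_cases hd : ∀ i, d i ≠ 0
  · have : critSet c d lam = Set.univ := by
      refine Set.eq_univ_of_forall fun x => ⟨fun i => by simpa [h0] using hd i, ?_⟩
      ext v
      simp [Subsingleton.elim v 0]
    rw [this, if_pos (by simpa [Finset.filter_eq_empty_iff] using hd), Nat.card_univ,
      Nat.card_unique, Nat.cast_one]
  · have : critSet c d lam = ∅ := by
      push Not at hd
      obtain ⟨i, hi⟩ := hd
      exact Set.eq_empty_of_forall_notMem fun x hx => hx.1 i (by simp [h0, hi])
    rw [this, if_neg (by simpa [Finset.filter_eq_empty_iff] using hd)]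
    simp

theorem IsEssential.resLin {ι : Type} {c : ι → V →L[ℂ] ℂ} (hc : IsEssential c) (h : ι) :
    IsEssential (resLin c h) := fun w hw => Subtype.ext (hc w hw)

/-- The generic number of critical points satisfies the deletion-restriction recursion. -/
theorem exists_polynomial_natCard_of_del_res [FiniteDimensional ℂ V] {c : ι → V →L[ℂ] ℂ}
    {d : ι → ℂ} {h : ι} {v0 p0 : V} (hv0 : c h v0 = 1) (hp0 : c h p0 + d h = 0)
    (hc : IsEssential c) (hc' : IsEssential (delLin c h)) {m n : ℕ} {P' P'' : MvPolynomial ι ℂ}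
    (hP' : P' ≠ 0) (hP'' : P'' ≠ 0)
    (hm : ∀ lam, MvPolynomial.eval lam P' ≠ 0 →
      Nat.card (critSet (delLin c h) (delConst d h) lam) = m)
    (hn : ∀ lam, MvPolynomial.eval lam P'' ≠ 0 →
      Nat.card (critSet (resLin c h) (resConst c d h p0) lam) = n) :
    ∃ P : MvPolynomial ι ℂ, P ≠ 0 ∧ ∀ lam, MvPolynomial.eval lam P ≠ 0 →
      Nat.card (critSet c d lam) = m + n := by
  have hch : c h ≠ 0 := by
    intro h0
    simp [h0] at hv0
  obtain ⟨P, hP, hgen, hconst⟩ := exists_polynomial_natCard_const hc d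
  obtain ⟨Q', hQ', hnd'⟩ := exists_polynomial_nondegenerate hc' (delConst d h)
  obtain ⟨Q'', hQ'', hnd''⟩ := exists_polynomial_nondegenerate (hc.resLin h) (resConst c d h p0)
  obtain ⟨R, hR, hav⟩ := exists_polynomial_critSet_avoids hc' (delConst d h) hch (d h)
  obtain ⟨lam1, hlam1⟩ : ∃ lam1, MvPolynomial.eval lam1 (P * P' * P'' * Q' * Q'' * R) ≠ 0 := by
    by_contra! h0
    refine mul_ne_zero (mul_ne_zero (mul_ne_zero (mul_ne_zero (mul_ne_zero hP hP') hP'') hQ') hQ'')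
      hR (MvPolynomial.funext fun x => by simpa using h0 x)
  simp only [map_mul, mul_ne_zero_iff] at hlam1
  obtain ⟨⟨⟨⟨⟨h1, h2⟩, h3⟩, h4⟩, h5⟩, h6⟩ := hlam1
  have hnr := (hgen lam1 h1).1
  let lam0 : ι → ℂ := Function.update lam1 h 0
  have hlamh : lam0 h = 0 := Function.update_self ..
  have hl : ∀ i ≠ h, lam1 i = lam0 i := fun i hi => (Function.update_of_ne hi ..).symm
  have hdel : ∀ i, delLin c h i ≠ 0 → lam1 i = lam0 i := by
    intro i hi
    refine hl i fun hh => hi ?_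
    rw [hh, delLin, Function.update_self]
  have hres : ∀ i, resLin c h i ≠ 0 → lam1 i = lam0 i := by
    intro i hi
    refine hl i fun hh => hi ?_
    subst hh
    ext v
    exact v.2
  have hsum : ∀ J : Finset ι, ∑ i ∈ J, lam0 i = 0 → J ⊆ {h} := by
    intro J hJ
    have : ∑ i ∈ J.erase h, lam1 i = 0 := by
      rw [← hJ, ← Finset.sum_erase J hlamh]
      exact Finset.sum_congr rfl fun i hi => hl i (Finset.ne_of_mem_erase hi)
    rw [Finset.subset_singleton_iff']
    intro i hi
    by_contra hih
    exact hnr _ ⟨i, Finset.mem_erase.2 ⟨hih, hi⟩⟩ this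
  have hnd1 := hnd' lam1 h4
  have hnd2 := hnd'' lam1 h5
  have hfin1 := finite_critSet hc' hnr hnd1
  have hfin2 := finite_critSet (hc.resLin h) hnr hnd2
  have hm1 := hm lam1 h2
  have hn1 := hn lam1 h3
  have hav1 := hav lam1 h6
  simp only [logHess_congr_weight hdel] at hnd1
  simp only [logHess_congr_weight hres] at hnd2
  rw [critSet_congr_weight hdel] at hnd1 hfin1 hm1 hav1
  rw [critSet_congr_weight hres] at hnd2 hfin2 hn1
  have hev := eventually_natCard_degenerate hv0 hp0 hlamh hsum hc' hfin1 hnd1 hav1 hfin2 hnd2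
  rw [hm1, hn1, eventually_nhdsWithin_iff] at hev
  obtain ⟨lam2, hlam2, hcard⟩ :=
    (mem_closure_iff_frequently.1 (dense_eval_ne_zero hP lam0)).and_eventually hev |>.exists
  refine ⟨P, hP, fun lam hlam => (hconst lam lam2 hlam hlam2).trans (hcard ?_)⟩
  have := (hgen lam2 hlam2).1 {h} (Finset.singleton_nonempty h)
  simpa using this

theorem exists_polynomial_natCard_critSet (n : ℕ) : ∀ {V : Type} [NormedAddCommGroup V]
    [NormedSpace ℂ V] [FiniteDimensional ℂ V] (c : ι → V →L[ℂ] ℂ) (d : ι → ℂ),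
    (Finset.univ.filter fun i => c i ≠ 0).card = n → IsEssential c →
    ∃ P : MvPolynomial ι ℂ, P ≠ 0 ∧ ∀ lam, MvPolynomial.eval lam P ≠ 0 →
      (Nat.card (critSet c d lam) : ℤ) = (-1) ^ Module.finrank ℂ V * eulerSum c d := by
  induction n using Nat.strong_induction_on with
  | _ n ih =>
  intro V _ _ _ c d hn hc
  by_cases h0 : ∀ i, c i = 0
  · exact ⟨1, one_ne_zero, fun lam _ => natCard_critSet_eq_of_forall_eq_zero hc h0 d lam⟩
  push Not at h0
  obtain ⟨h, hch⟩ := h0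
  by_cases hc' : IsEssential (delLin c h)
  · obtain ⟨v, hv⟩ : ∃ v, c h v ≠ 0 := by
      by_contra! hall
      exact hch (ContinuousLinearMap.ext hall)
    have hv0 : c h ((c h v)⁻¹ • v) = 1 := by
      rw [map_smul, smul_eq_mul, inv_mul_cancel₀ hv]
    have hp0 : c h (-d h • ((c h v)⁻¹ • v)) + d h = 0 := by
      rw [map_smul, hv0, smul_eq_mul, mul_one, neg_add_cancel]
    generalize (c h v)⁻¹ • v = v0 at hv0 hp0
    generalize -d h • v0 = p0 at hp0
    have hlt' : (Finset.univ.filter fun i => delLin c h i ≠ 0).card < n := by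
      rw [← hn]
      refine Finset.card_lt_card (Finset.ssubset_iff_of_subset ?_ |>.2 ⟨h, by simpa using hch, ?_⟩)
      · intro i
        simp only [Finset.mem_filter, Finset.mem_univ, true_and]
        by_cases hi : i = h <;> simp [delLin, hi]
      · simp only [Finset.mem_filter, Finset.mem_univ, true_and, not_not]
        simp [delLin]
    have hlt'' : (Finset.univ.filter fun i => resLin c h i ≠ 0).card < n := by
      rw [← hn]
      refine Finset.card_lt_card (Finset.ssubset_iff_of_subset ?_ |>.2 ⟨h, by simpa using hch, ?_⟩)
      · intro i
        simp only [Finset.mem_filter, Finset.mem_univ, true_and]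
        refine mt fun hi => ?_
        rw [resLin, hi, ContinuousLinearMap.zero_comp]
      · simp only [Finset.mem_filter, Finset.mem_univ, true_and, not_not]
        ext v
        exact v.2
    obtain ⟨P', hP', hcard'⟩ := ih _ hlt' (delLin c h) (delConst d h) rfl hc'
    obtain ⟨P'', hP'', hcard''⟩ := ih _ hlt'' (resLin c h) (resConst c d h p0) rfl (hc.resLin h)
    obtain ⟨lam', hlam'⟩ := (dense_eval_ne_zero hP').nonempty
    obtain ⟨lam'', hlam''⟩ := (dense_eval_ne_zero hP'').nonempty
    obtain ⟨P, hP, hcard⟩ := exists_polynomial_natCard_of_del_res hv0 hp0 hc hc' hP' hP''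
      (fun lam hlam => Nat.cast_injective (R := ℤ)
        ((hcard' lam hlam).trans (hcard' lam' hlam').symm))
      (fun lam hlam => Nat.cast_injective (R := ℤ)
        ((hcard'' lam hlam).trans (hcard'' lam'' hlam'').symm))
    refine ⟨P, hP, fun lam hlam => ?_⟩
    have hrank : Module.finrank ℂ V = Module.finrank ℂ (hyperDir c h) + 1 :=
      (Module.Dual.finrank_ker_add_one_of_ne_zero (f := (c h).toLinearMap) fun h0 =>
        hch (ContinuousLinearMap.coe_injective h0)).symm
    rw [hcard lam hlam, Nat.cast_add, hcard' lam' hlam', hcard'' lam'' hlam'',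
      eulerSum_eq_sub hp0, hrank]
    ring
  · simp only [IsEssential, not_forall] at hc'
    obtain ⟨v, hv, hv0⟩ := hc'
    have hvi : ∀ i ≠ h, c i v = 0 := by
      intro i hi
      simpa [delLin, hi] using hv i
    have hvh : c h v ≠ 0 := by
      intro hh
      refine hv0 (hc v fun i => ?_)
      by_cases hi : i = h
      · rw [hi, hh]
      · exact hvi i hi
    refine ⟨MvPolynomial.X h, MvPolynomial.X_ne_zero h, fun lam hlam => ?_⟩
    rw [MvPolynomial.eval_X] at hlam
    have : critSet c d lam = ∅ := by
      refine Set.eq_empty_of_forall_notMem fun x hx => ?_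
      have h1 := DFunLike.congr_fun hx.2 v
      rw [logForm, sum_apply, Finset.sum_eq_single h] at h1
      · simp [hlam, hx.1 h, hvh] at h1
      · intro i _ hi
        simp [hvi i hi]
      · simp
    rw [this, eulerSum_eq_zero hvi hvh]
    simp

end Arrangement

section Whitney

variable {ι V : Type} [Fintype ι]

/-- The common points of the hyperplanes of a subfamily. -/
def interFlat (H : ι → Set V) (S : Finset ι) : Set V := {x | ∀ i ∈ S, x ∈ H i}

theorem mem_interPosetIn_univ_iff {H : ι → Set V} {X : Set V} :
    X ∈ interPosetIn Set.univ (Finset.univ.image H) ↔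
      X.Nonempty ∧ ∃ S : Finset ι, interFlat H S = X := by
  rw [interPosetIn, Finset.mem_filter, Finset.mem_image, and_comm]
  refine and_congr_right fun _ => ?_
  constructor
  · rintro ⟨T, hT, rfl⟩
    rw [Finset.mem_powerset, Finset.subset_image_iff] at hT
    obtain ⟨S, -, rfl⟩ := hT
    exact ⟨S, by ext x; simp [interFlat]⟩
  · rintro ⟨S, rfl⟩
    exact ⟨S.image H, Finset.mem_powerset.2 (Finset.image_subset_image (Finset.subset_univ S)),
      by ext x; simp [interFlat]⟩

/-- The alternating number of subfamilies with a prescribed intersection. -/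
noncomputable def whitneySum (H : ι → Set V) (X : Set V) : ℤ :=
  ∑ S : Finset ι with interFlat H S = X, (-1) ^ S.card

theorem isMobiusIn_whitneySum {H : ι → Set V} (hH : ∀ i, H i ≠ Set.univ) :
    IsMobiusIn Set.univ (Finset.univ.image H) (whitneySum H) := by
  intro X hX
  obtain ⟨hne, S0, hS0⟩ := mem_interPosetIn_univ_iff.1 hX
  have hfib : ∑ Y ∈ (interPosetIn Set.univ (Finset.univ.image H)).filter fun Y => X ⊆ Y,
      whitneySum H Y = ∑ S : Finset ι with X ⊆ interFlat H S, (-1) ^ S.card := by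
    rw [← Finset.sum_fiberwise_of_maps_to (g := interFlat H)
      (t := (interPosetIn Set.univ (Finset.univ.image H)).filter fun Y => X ⊆ Y)]
    · refine Finset.sum_congr rfl fun Y hY => ?_
      rw [whitneySum, Finset.filter_filter]
      refine Finset.sum_congr ?_ fun _ _ => rfl
      refine Finset.filter_congr fun S _ => ⟨fun h => ⟨?_, h⟩, fun h => h.2⟩
      rw [h]
      exact (Finset.mem_filter.1 hY).2
    · intro S hS
      have hXS := (Finset.mem_filter.1 hS).2
      exact Finset.mem_filter.2 ⟨mem_interPosetIn_univ_iff.2 ⟨hne.mono hXS, S, rfl⟩, hXS⟩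
  have hpow : (Finset.univ.filter fun S : Finset ι => X ⊆ interFlat H S) =
      (Finset.univ.filter fun i => X ⊆ H i).powerset := by
    ext S
    simp only [Finset.mem_filter, Finset.mem_univ, true_and, Finset.mem_powerset,
      Finset.subset_iff]
    exact ⟨fun h i hi x hx => h hx i hi, fun h x hx i hi => h hi hx⟩
  rw [hfib, hpow, Finset.sum_powerset_neg_one_pow_card]
  refine if_congr ?_ rfl rfl
  rw [Finset.filter_eq_empty_iff]
  constructor
  · intro h
    rw [← hS0, Set.eq_univ_iff_forall]
    intro x i hi
    refine absurd ?_ (h (Finset.mem_univ i))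
    rw [← hS0]
    exact fun y hy => hy i hi
  · rintro rfl i - hi
    exact hH i (Set.univ_subset_iff.1 hi)

theorem IsMobiusIn.eq_of_mem {W : Set V} {A : Finset (Set V)} {μ ν : Set V → ℤ}
    (hμ : IsMobiusIn W A μ) (hν : IsMobiusIn W A ν) {X : Set V} (hX : X ∈ interPosetIn W A) :
    μ X = ν X := by
  induction hn : ((interPosetIn W A).filter fun Y => X ⊂ Y).card using Nat.strong_induction_on
    generalizing X with
  | _ n ih =>
  have hsplit : ∀ κ : Set V → ℤ, ∑ Y ∈ (interPosetIn W A).filter (fun Y => X ⊆ Y), κ Y =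
      κ X + ∑ Y ∈ (interPosetIn W A).filter (fun Y => X ⊂ Y), κ Y := by
    intro κ
    rw [← Finset.add_sum_erase _ _ (Finset.mem_filter.2 ⟨hX, subset_rfl⟩)]
    congr 1
    refine Finset.sum_congr ?_ fun _ _ => rfl
    ext Y
    simp only [Finset.mem_erase, Finset.mem_filter, Set.ssubset_iff_subset_ne, ne_eq]
    tauto
  have h1 := hμ X hX
  rw [← hν X hX, hsplit, hsplit, Finset.sum_congr rfl fun Y hY => ?_] at h1
  · exact add_right_cancel h1
  · obtain ⟨hYL, hXY⟩ := Finset.mem_filter.1 hY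
    refine ih _ ?_ hYL rfl
    rw [← hn]
    refine Finset.card_lt_card ((Finset.ssubset_iff_of_subset ?_).2 ⟨Y, hY, ?_⟩)
    · intro Z hZ
      exact Finset.mem_filter.2 ⟨(Finset.mem_filter.1 hZ).1, hXY.trans (Finset.mem_filter.1 hZ).2⟩
    · exact fun hY' => (Finset.mem_filter.1 hY').2.ne rfl

/-- Whitney's theorem, specialised to the sum of all values of the Möbius function. -/
theorem sum_mobius_eq {H : ι → Set V} (hH : ∀ i, H i ≠ Set.univ) {μ : Set V → ℤ}
    (hμ : IsMobiusIn Set.univ (Finset.univ.image H) μ) :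
    ∑ X ∈ interPosetIn Set.univ (Finset.univ.image H), μ X =
      ∑ S : Finset ι, if (interFlat H S).Nonempty then (-1) ^ S.card else 0 := by
  rw [Finset.sum_congr rfl fun X hX => hμ.eq_of_mem (isMobiusIn_whitneySum hH) hX,
    ← Finset.sum_filter, ← Finset.sum_fiberwise_of_maps_to (g := interFlat H)
      (t := interPosetIn Set.univ (Finset.univ.image H))]
  · refine Finset.sum_congr rfl fun X hX => ?_
    rw [whitneySum, Finset.filter_filter]
    refine Finset.sum_congr ?_ fun _ _ => rfl
    refine Finset.filter_congr fun S _ => ⟨fun h => ⟨?_, h⟩, fun h => h.2⟩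
    rw [h]
    exact (mem_interPosetIn_univ_iff.1 hX).1
  · intro S hS
    exact mem_interPosetIn_univ_iff.2 ⟨(Finset.mem_filter.1 hS).2, S, rfl⟩

theorem eval_poinIn_neg_one {V : Type} [AddCommGroup V] (K : Type) [Field K] [Module K V]
    (W : Set V) (A : Finset (Set V)) (μ : Set V → ℤ) :
    (poinIn K W A μ).eval (-1) = ∑ X ∈ interPosetIn W A, μ X := by
  simp [poinIn, Polynomial.eval_finsetSum]

end Whitney

theorem isEssential_of_rkIn_eq {ι : Type} [Fintype ι] {ℓ : ℕ} {c : ι → (Fin ℓ → ℂ) →L[ℂ] ℂ}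
    {d : ι → ℂ} (h : ∃ X ∈ interPosetIn Set.univ
      (Finset.univ.image fun i => {x : Fin ℓ → ℂ | c i x + d i = 0}),
      rkIn ℂ Set.univ X = ℓ) : IsEssential c := by
  obtain ⟨X, hX, hrk⟩ := h
  obtain ⟨⟨x, hx⟩, S, rfl⟩ := mem_interPosetIn_univ_iff.1 hX
  intro v hv
  rw [rkIn, flatDim, AffineSubspace.span_univ, AffineSubspace.direction_top, finrank_top,
    Module.finrank_fin_fun] at hrk
  rcases Nat.eq_zero_or_pos ℓ with rfl | hl
  · exact Subsingleton.elim _ _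
  · have h0 : flatDim ℂ (interFlat (fun i => {x : Fin ℓ → ℂ | c i x + d i = 0}) S) = 0 := by
      omega
    rw [flatDim, Submodule.finrank_eq_zero] at h0
    have hxv : x + v ∈ interFlat (fun i => {x : Fin ℓ → ℂ | c i x + d i = 0}) S := by
      intro i hi
      have : c i x + d i = 0 := hx i hi
      rw [Set.mem_ofPred_eq, map_add, hv i, add_zero, this]
    have hmem := AffineSubspace.vsub_mem_direction (subset_affineSpan ℂ _ hxv)
      (subset_affineSpan ℂ _ hx)
    rw [h0, Submodule.mem_bot] at hmem
    simpa using hmem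

/-- The number of critical points of a generic master function, together with their finiteness and
nondegeneracy. -/
theorem exists_polynomial_generic {ι : Type} [Fintype ι] {ℓ : ℕ} {c : ι → (Fin ℓ → ℂ) →L[ℂ] ℂ}
    {d : ι → ℂ} (hc : ∀ i, c i ≠ 0) {μ : Set (Fin ℓ → ℂ) → ℤ}
    (hess : ∃ X ∈ interPosetIn Set.univ
      (Finset.univ.image fun i => {x : Fin ℓ → ℂ | c i x + d i = 0}),
      rkIn ℂ Set.univ X = ℓ)
    (hμ : IsMobiusIn Set.univ
      (Finset.univ.image fun i => {x : Fin ℓ → ℂ | c i x + d i = 0}) μ) :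
    ∃ P : MvPolynomial ι ℂ, P ≠ 0 ∧ ∀ lam, MvPolynomial.eval lam P ≠ 0 →
      (critSet c d lam).Finite ∧
      (∀ x ∈ critSet c d lam, Function.Bijective (fderiv ℂ (logForm c d lam) x)) ∧
      Nat.card (critSet c d lam) = ((poinIn ℂ Set.univ
        (Finset.univ.image fun i => {x : Fin ℓ → ℂ | c i x + d i = 0}) μ).eval (-1)).natAbs := by
  have hE := isEssential_of_rkIn_eq hess
  obtain ⟨P, hP, hgen, -⟩ := exists_polynomial_natCard_const hE d
  obtain ⟨Q, hQ, hcard⟩ := exists_polynomial_natCard_critSet _ c d rfl hE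
  refine ⟨P * Q, mul_ne_zero hP hQ, fun lam hlam => ?_⟩
  rw [map_mul, mul_ne_zero_iff] at hlam
  obtain ⟨hnr, hnd⟩ := hgen lam hlam.1
  refine ⟨finite_critSet hE hnr hnd, fun x hx => ?_, ?_⟩
  · rw [(hasFDerivAt_logForm lam hx.1).fderiv]
    have hinj : Function.Injective (logHess c d lam x).toLinearMap :=
      (injective_iff_map_eq_zero _).2 (hnd x hx)
    exact ⟨hinj, (LinearMap.injective_iff_surjective_of_finrank_eq_finrank
      (finrank_continuousDual (V := Fin ℓ → ℂ)).symm).1 hinj⟩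
  · have hH : ∀ i, {x : Fin ℓ → ℂ | c i x + d i = 0} ≠ Set.univ := by
      intro i h
      have h' : ∀ x, c i x + d i = 0 := Set.eq_univ_iff_forall.1 h
      refine hc i (ContinuousLinearMap.ext fun x => ?_)
      have h0 := h' 0
      rw [map_zero, zero_add] at h0
      simpa [h0] using h' x
    have hsum : eulerSum c d = ∑ S : Finset ι,
        if (interFlat (fun i => {x : Fin ℓ → ℂ | c i x + d i = 0}) S).Nonempty
          then (-1) ^ S.card else 0 := rfl
    rw [eval_poinIn_neg_one, sum_mobius_eq hH hμ, ← hsum, ← Int.natAbs_natCast (Nat.card _),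
      hcard lam hlam.2, Int.natAbs_mul, Int.natAbs_pow, Int.natAbs_neg, Int.natAbs_one, one_pow,
      one_mul]

/-- **Varchenko's conjecture; Orlik–Terao, Silvotti.** For an essential
arrangement of `N` affine hyperplanes `{f_i = 0}` in `ℂ^ℓ`, there is a proper
Zariski-closed subset `Y ⊊ ℂ^N` such that for every `λ ∉ Y`: the zero set of the
logarithmic form `ω_λ` on `M(A)` is finite, at each zero the derivative of
`ω_λ : M(A) → (ℂ^ℓ)*` is a linear isomorphism, and the number of zeros equals
`β(A) = |π(A,-1)|`. -/
theorem varchenko_critical_points {ℓ N : ℕ}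
    (c : Fin N → Fin ℓ → ℂ) (d : Fin N → ℂ) (hc : ∀ i, c i ≠ 0)
    (A : Finset (Set (Fin ℓ → ℂ)))
    (hAdef : A = Finset.image
      (fun i => {x : Fin ℓ → ℂ | (∑ j, c i j * x j) + d i = 0}) Finset.univ)
    (hess : ∃ X ∈ interPosetIn Set.univ A, rkIn ℂ Set.univ X = ℓ)
    (μ : Set (Fin ℓ → ℂ) → ℤ) (hμ : IsMobiusIn Set.univ A μ) :
    ∃ Y : Set (Fin N → ℂ),
      (∃ S : Set (MvPolynomial (Fin N) ℂ),
        Y = {lam | ∀ p ∈ S, MvPolynomial.eval lam p = 0}) ∧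
      Y ≠ Set.univ ∧
      ∀ lam : Fin N → ℂ, lam ∉ Y →
        {x : Fin ℓ → ℂ | (∀ i, (∑ j, c i j * x j) + d i ≠ 0) ∧
            masterForm c d lam x = 0}.Finite ∧
        (∀ x : Fin ℓ → ℂ, (∀ i, (∑ j, c i j * x j) + d i ≠ 0) →
          masterForm c d lam x = 0 →
            Function.Bijective (fderiv ℂ (masterForm c d lam) x)) ∧
        Nat.card {x : Fin ℓ → ℂ // (∀ i, (∑ j, c i j * x j) + d i ≠ 0) ∧
            masterForm c d lam x = 0}
          = ((poinIn ℂ Set.univ A μ).eval (-1)).natAbs := by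
  let C : Fin N → (Fin ℓ → ℂ) →L[ℂ] ℂ := fun i =>
    ∑ j, c i j • (ContinuousLinearMap.proj j : (Fin ℓ → ℂ) →L[ℂ] ℂ)
  have hC : ∀ i x, ∑ j, c i j * x j = C i x := by
    intro i x
    simp [C, sum_apply]
  have hC0 : ∀ i, C i ≠ 0 := by
    intro i h0
    refine hc i (funext fun j => ?_)
    have := hC i (Pi.single j 1)
    rw [h0] at this
    simpa [Pi.single_apply] using this
  have hform : ∀ lam, masterForm c d lam = logForm C d lam := by
    intro lam
    funext x
    simp only [masterForm, hC]
    rfl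
  simp only [hC] at hAdef ⊢
  simp only [hform]
  subst hAdef
  obtain ⟨P, hP, hgen⟩ := exists_polynomial_generic hC0 hess hμ
  refine ⟨{lam | ∀ p ∈ ({P} : Set (MvPolynomial (Fin N) ℂ)), MvPolynomial.eval lam p = 0},
    ⟨{P}, rfl⟩, fun h => hP (MvPolynomial.funext fun x => ?_), fun lam hlam => ?_⟩
  · have : ∀ p ∈ ({P} : Set (MvPolynomial (Fin N) ℂ)), MvPolynomial.eval x p = 0 :=
      Set.eq_univ_iff_forall.1 h x
    simpa using this
  · have hlam' : MvPolynomial.eval lam P ≠ 0 := by simpa using hlam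
    obtain ⟨h1, h2, h3⟩ := hgen lam hlam'
    exact ⟨h1, fun x hx hx' => h2 x ⟨hx, hx'⟩, h3⟩
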